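/- Over the class of all Kripke trees, MSO < CoWMSO and WMSO < CoWMSO. Over the class of finitely-branching Kripke trees, MSO ≡ CoWMSO and WMSO < CoWMSO. -/

import Mathlib

/-! ## Trees over ℕ* -/

abbrev Node : Type := List ℕ

/-- `T` is a tree with root `r`: `r ∈ T`, every node extends `r`, and `T` is
prefix-closed above `r`. -/
def IsTreeRooted (T : Set Node) (r : Node) : Prop :=
  r ∈ T ∧ (∀ τ ∈ T, r <+: τ) ∧
    ∀ σ σ' : List ℕ, r ++ σ ∈ T → σ' <+: σ → r ++ σ' ∈ T

/-- `T ⊆ ℕ*` is a tree. -/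
def IsTree (T : Set Node) : Prop := ∃ r : Node, IsTreeRooted T r

/-- `τ'` is a child of `τ` in `T`. -/
def childIn (T : Set Node) (τ τ' : Node) : Prop := τ' ∈ T ∧ ∃ n : ℕ, τ' = τ ++ [n]

/-- every node of `T` has a child in `T`. -/
def NonBlocking (T : Set Node) : Prop := ∀ τ ∈ T, ∃ n : ℕ, τ ++ [n] ∈ T

/-- every node of `T` has finitely many children in `T`. -/
def FinBranching (T : Set Node) : Prop := ∀ τ ∈ T, {τ' : Node | childIn T τ τ'}.Finite

/-- `S` is a subtree of `T`. -/
def IsSubtree (T S : Set Node) : Prop := S ⊆ T ∧ IsTree S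

/-- `P` is a path of `T`: a subtree totally ordered by the child relation
(each node has at most one child in `P`). -/
def IsPathOf (T P : Set Node) : Prop :=
  IsSubtree T P ∧ ∀ τ ∈ P, ∀ n m : ℕ, τ ++ [n] ∈ P → τ ++ [m] ∈ P → n = m

/-- `T` is a chain: a tree in which each node has at most one child. -/
def IsChainTree (T : Set Node) : Prop :=
  IsTree T ∧ ∀ τ ∈ T, ∀ n m : ℕ, τ ++ [n] ∈ T → τ ++ [m] ∈ T → n = m

/-- `T` is dense: it contains a subtree every node of which has a descendant
in the subtree with at least two distinct children in the subtree. -/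
def DenseTree (T : Set Node) : Prop :=
  ∃ S : Set Node, IsSubtree T S ∧ ∀ τ ∈ S, ∃ τ' ∈ S, τ <+: τ' ∧
    ∃ n m : ℕ, n ≠ m ∧ τ' ++ [n] ∈ S ∧ τ' ++ [m] ∈ S

/-- A Kripke tree over `AP`: a non-blocking tree together with a labelling. -/
structure KripkeTree (AP : Type) where
  T : Set Node
  root : Node
  rooted : IsTreeRooted T root
  nonblocking : NonBlocking T
  Lab : Node → Set AP

/-! ## MSOL syntax -/

inductive MSOL (AP : Type) : Type
  | atom : AP → ℕ → MSOL AP          -- P_a(x)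
  | le   : ℕ → ℕ → MSOL AP           -- x ≤ y
  | mem  : ℕ → ℕ → MSOL AP           -- x ∈ X
  | not  : MSOL AP → MSOL AP
  | and  : MSOL AP → MSOL AP → MSOL AP
  | exFO : ℕ → MSOL AP → MSOL AP     -- ∃x. φ
  | exSO : ℕ → MSOL AP → MSOL AP     -- ∃X. φ

namespace MSOL

def freeFO {AP : Type} : MSOL AP → Set ℕ
  | atom _ x => {x}
  | le x y => {x, y}
  | mem x _ => {x}
  | not φ => φ.freeFO
  | and φ ψ => φ.freeFO ∪ ψ.freeFO
  | exFO x φ => φ.freeFO \ {x}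
  | exSO _ φ => φ.freeFO

def freeSO {AP : Type} : MSOL AP → Set ℕ
  | atom _ _ => ∅
  | le _ _ => ∅
  | mem _ X => {X}
  | not φ => φ.freeSO
  | and φ ψ => φ.freeSO ∪ ψ.freeSO
  | exFO _ φ => φ.freeSO
  | exSO X φ => φ.freeSO \ {X}

/-- A sentence is a formula with no free variables. -/
def IsSentence {AP : Type} (φ : MSOL AP) : Prop := φ.freeFO = ∅ ∧ φ.freeSO = ∅

/-- The first-order fragment: no second-order variables. -/
def IsFO {AP : Type} : MSOL AP → Prop
  | atom _ _ => True
  | le _ _ => True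
  | mem _ _ => False
  | not φ => φ.IsFO
  | and φ ψ => φ.IsFO ∧ ψ.IsFO
  | exFO _ φ => φ.IsFO
  | exSO _ _ => False

end MSOL

/-! ## MSOL semantics, parametrized by the range of second-order quantifiers -/

/-- A second-order domain: for each tree, the collection of sets that
second-order quantifiers range over. -/
abbrev SODom : Type := Set Node → Set (Set Node)

def Sat {AP : Type} (D : SODom) (K : KripkeTree AP) :
    (ℕ → Node) → (ℕ → Set Node) → MSOL AP → Prop
  | V1, _,  .atom a x => V1 x ∈ K.T ∧ a ∈ K.Lab (V1 x)
  | V1, _,  .le x y => V1 x ∈ K.T ∧ V1 y ∈ K.T ∧ V1 x <+: V1 y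
  | V1, V2, .mem x X => V1 x ∈ V2 X
  | V1, V2, .not φ => ¬ Sat D K V1 V2 φ
  | V1, V2, .and φ ψ => Sat D K V1 V2 φ ∧ Sat D K V1 V2 ψ
  | V1, V2, .exFO x φ => ∃ τ ∈ K.T, Sat D K (Function.update V1 x τ) V2 φ
  | V1, V2, .exSO X φ => ∃ S ∈ D K.T, Sat D K V1 (Function.update V2 X S) φ

/-- A logic: a syntactic fragment of MSOL together with a second-order domain. -/
structure MLogic (AP : Type) where
  syn : MSOL AP → Prop
  dom : SODom

namespace MLogic

/-- A Kripke tree satisfies a sentence. -/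
def KSat {AP : Type} (L : MLogic AP) (K : KripkeTree AP) (φ : MSOL AP) : Prop :=
  ∃ V1 V2, Sat L.dom K V1 V2 φ

/-- `L ≤ L'` over the class `M`. -/
def Leq {AP : Type} (M : Set (KripkeTree AP)) (L L' : MLogic AP) : Prop :=
  ∀ φ : MSOL AP, φ.IsSentence → L.syn φ →
    ∃ φ' : MSOL AP, φ'.IsSentence ∧ L'.syn φ' ∧
      ∀ K ∈ M, (L.KSat K φ ↔ L'.KSat K φ')

/-- `L < L'` over the class `M`. -/
def Lt {AP : Type} (M : Set (KripkeTree AP)) (L L' : MLogic AP) : Prop :=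
  Leq M L L' ∧ ¬ Leq M L' L

/-- `L ≡ L'` over the class `M`. -/
def EquivExp {AP : Type} (M : Set (KripkeTree AP)) (L L' : MLogic AP) : Prop :=
  Leq M L L' ∧ Leq M L' L

/-- `L` and `L'` are expressively incomparable over the class `M`. -/
def Incomp {AP : Type} (M : Set (KripkeTree AP)) (L L' : MLogic AP) : Prop :=
  ¬ Leq M L L' ∧ ¬ Leq M L' L

end MLogic

/-! ## The concrete logics -/

def MSOdom : SODom := fun T => {S | S ⊆ T}
def MTLdom : SODom := fun T => {S | S ⊆ T ∧ IsTree S}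
def MPLdom : SODom := fun T => {S | IsPathOf T S}
def weakDom (D : SODom) : SODom := fun T => {S | S ∈ D T ∧ S.Finite}
def coweakDom (D : SODom) : SODom := fun T => {S | S ∈ D T ∧ S.Infinite}

def MSO (AP : Type) : MLogic AP := ⟨fun _ => True, MSOdom⟩
def MTL (AP : Type) : MLogic AP := ⟨fun _ => True, MTLdom⟩
def MPL (AP : Type) : MLogic AP := ⟨fun _ => True, MPLdom⟩
def WMSO (AP : Type) : MLogic AP := ⟨fun _ => True, weakDom MSOdom⟩
def WMTL (AP : Type) : MLogic AP := ⟨fun _ => True, weakDom MTLdom⟩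
def WMPL (AP : Type) : MLogic AP := ⟨fun _ => True, weakDom MPLdom⟩
def CoWMSO (AP : Type) : MLogic AP := ⟨fun _ => True, coweakDom MSOdom⟩
def CoWMTL (AP : Type) : MLogic AP := ⟨fun _ => True, coweakDom MTLdom⟩
def CoWMPL (AP : Type) : MLogic AP := ⟨fun _ => True, coweakDom MPLdom⟩
def FOL (AP : Type) : MLogic AP := ⟨MSOL.IsFO, MSOdom⟩

/-! ## Classes of Kripke trees -/

def allKT (AP : Type) : Set (KripkeTree AP) := Set.univ
def finBrKT (AP : Type) : Set (KripkeTree AP) := {K | FinBranching K.T}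
/-- Kripke trees whose underlying tree is an infinite chain
(every node has exactly one child). -/
def chainKT (AP : Type) : Set (KripkeTree AP) :=
  {K | ∀ τ ∈ K.T, ∃! τ' : Node, childIn K.T τ τ'}



/-! ## Translations -/

set_option linter.all false

namespace S13

open MSOL

theorem infinite_T {AP : Type} (K : KripkeTree AP) : K.T.Infinite := by
  intro hfin
  obtain ⟨m, hm, hmax⟩ := Set.exists_max_image K.T List.length hfin ⟨_, K.rooted.1⟩
  obtain ⟨n, hn⟩ := K.nonblocking m hm
  have := hmax _ hn
  simp at this

theorem split_infinite {T S : Set Node} (hT : T.Infinite) (hS : S ⊆ T) :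
    ∃ A B : Set Node, A ⊆ T ∧ A.Infinite ∧ B ⊆ T ∧ B.Infinite ∧ S = A ∩ B := by
  by_cases h : (T \ S).Infinite
  · have := h.to_subtype
    let e := Infinite.natEmbedding (↥(T \ S))
    let C : Set Node := Set.range fun n => (e (2 * n)).1
    let D : Set Node := Set.range fun n => (e (2 * n + 1)).1
    have hC : C.Infinite := Set.infinite_range_of_injective fun a b hab => by
      have := e.injective (Subtype.ext hab); omega
    have hD : D.Infinite := Set.infinite_range_of_injective fun a b hab => by
      have := e.injective (Subtype.ext hab); omega
    refine ⟨S ∪ C, S ∪ D, ?_, hC.mono Set.subset_union_right, ?_,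
      hD.mono Set.subset_union_right, ?_⟩
    · rintro x (hx | ⟨n, rfl⟩)
      exacts [hS hx, (e _).2.1]
    · rintro x (hx | ⟨n, rfl⟩)
      exacts [hS hx, (e _).2.1]
    · ext x
      constructor
      · intro hx; exact ⟨Or.inl hx, Or.inl hx⟩
      · rintro ⟨hx | ⟨n, rfl⟩, hy⟩
        · exact hx
        · rcases hy with hy | ⟨m, hm⟩
          · exact hy
          · have := e.injective (Subtype.ext hm); omega
  · have hSi : S.Infinite := by
      intro hf
      exact hT ((hf.union (Set.not_infinite.1 h)).subset (by
        intro x hx; by_cases hxs : x ∈ S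
        · exact Or.inl hxs
        · exact Or.inr ⟨hx, hxs⟩))
    exact ⟨S, S, hS, hSi, hS, hSi, by simp⟩

/-- MSO to CoWMSO. -/
def tr {AP : Type} : MSOL AP → MSOL AP
  | atom a x => atom a x
  | le x y => le x y
  | mem x X => MSOL.and (mem x (2 * X)) (mem x (2 * X + 1))
  | MSOL.not φ => MSOL.not (tr φ)
  | MSOL.and φ ψ => MSOL.and (tr φ) (tr ψ)
  | exFO x φ => exFO x (tr φ)
  | exSO X φ => exSO (2 * X) (exSO (2 * X + 1) (tr φ))

/-- `X_(2X) ∩ X_(2X+1)` is finite, in CoWMSO. -/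
def finF {AP : Type} (X : ℕ) : MSOL AP :=
  MSOL.not (exSO (2 * X + 2) (MSOL.not (exFO 0 (MSOL.and (mem 0 (2 * X + 2))
    (MSOL.not (MSOL.and (mem 0 (2 * X)) (mem 0 (2 * X + 1))))))))

/-- WMSO to CoWMSO. -/
def trw {AP : Type} : MSOL AP → MSOL AP
  | atom a x => atom a x
  | le x y => le x y
  | mem x X => MSOL.and (mem x (2 * X)) (mem x (2 * X + 1))
  | MSOL.not φ => MSOL.not (trw φ)
  | MSOL.and φ ψ => MSOL.and (trw φ) (trw ψ)
  | exFO x φ => exFO x (trw φ)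
  | exSO X φ => exSO (2 * X) (exSO (2 * X + 1) (MSOL.and (finF X) (trw φ)))

/-- `X` is infinite, in MSO. -/
def infF {AP : Type} (X : ℕ) : MSOL AP :=
  exSO (X + 1) (MSOL.and (exFO 0 (mem 0 (X + 1)))
    (MSOL.not (exFO 0 (MSOL.and (mem 0 (X + 1)) (MSOL.not (and
      (exFO 1 (MSOL.and (mem 1 (X + 1)) (MSOL.and (le 0 1) (MSOL.not (le 1 0)))))
      (exFO 1 (MSOL.and (mem 1 X) (le 0 1)))))))))

/-- CoWMSO to MSO. -/
def trc {AP : Type} : MSOL AP → MSOL AP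
  | atom a x => atom a x
  | le x y => le x y
  | mem x X => mem x X
  | MSOL.not φ => MSOL.not (trc φ)
  | MSOL.and φ ψ => MSOL.and (trc φ) (trc ψ)
  | exFO x φ => exFO x (trc φ)
  | exSO X φ => exSO X (MSOL.and (infF X) (trc φ))

theorem tr_FO {AP : Type} (φ : MSOL AP) : (tr φ).freeFO = φ.freeFO := by
  induction φ <;> simp_all [tr, freeFO]

theorem finF_FO {AP : Type} (X : ℕ) : (finF X : MSOL AP).freeFO = ∅ := by
  simp [finF, freeFO]

theorem finF_SO {AP : Type} (X : ℕ) : (finF X : MSOL AP).freeSO ⊆ {2 * X, 2 * X + 1} := by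
  intro y
  simp [finF, freeSO]
  tauto

theorem infF_FO {AP : Type} (X : ℕ) : (infF X : MSOL AP).freeFO = ∅ := by
  ext y
  simp [infF, freeFO]

theorem infF_SO {AP : Type} (X : ℕ) : (infF X : MSOL AP).freeSO ⊆ {X} := by
  intro y
  simp [infF, freeSO]

theorem trw_FO {AP : Type} (φ : MSOL AP) : (trw φ).freeFO = φ.freeFO := by
  induction φ <;> simp_all [trw, freeFO, finF_FO]

theorem trc_FO {AP : Type} (φ : MSOL AP) : (trc φ).freeFO = φ.freeFO := by
  induction φ <;> simp_all [trc, freeFO, infF_FO]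

theorem tr_SO {AP : Type} (φ : MSOL AP) : ∀ Y ∈ (tr φ).freeSO, Y / 2 ∈ φ.freeSO := by
  induction φ with
  | atom a x => simp [tr, freeSO]
  | le x y => simp [tr, freeSO]
  | mem x X => simp [tr, freeSO]; omega
  | not φ ih => simpa [tr, freeSO] using ih
  | and φ ψ ih1 ih2 =>
    simp only [tr, freeSO]
    rintro Y (h | h)
    exacts [Or.inl (ih1 _ h), Or.inr (ih2 _ h)]
  | exFO x φ ih => simpa [tr, freeSO] using ih
  | exSO X φ ih =>
    simp only [tr, freeSO]
    rintro Y ⟨⟨h, h1⟩, h2⟩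
    refine ⟨ih _ h, ?_⟩
    simp only [Set.mem_singleton_iff] at *
    omega

theorem trw_SO {AP : Type} (φ : MSOL AP) : ∀ Y ∈ (trw φ).freeSO, Y / 2 ∈ φ.freeSO := by
  induction φ with
  | atom a x => simp [trw, freeSO]
  | le x y => simp [trw, freeSO]
  | mem x X => simp [trw, freeSO]; omega
  | not φ ih => simpa [trw, freeSO] using ih
  | and φ ψ ih1 ih2 =>
    simp only [trw, freeSO]
    rintro Y (h | h)
    exacts [Or.inl (ih1 _ h), Or.inr (ih2 _ h)]
  | exFO x φ ih => simpa [trw, freeSO] using ih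
  | exSO X φ ih =>
    simp only [trw, freeSO]
    rintro Y ⟨⟨h, h1⟩, h2⟩
    rcases h with h | h
    · have := finF_SO X h
      simp only [Set.mem_singleton_iff, Set.mem_insert_iff] at *
      tauto
    refine ⟨ih _ h, ?_⟩
    simp only [Set.mem_singleton_iff] at *
    omega

theorem trc_SO {AP : Type} (φ : MSOL AP) : ∀ Y ∈ (trc φ).freeSO, Y ∈ φ.freeSO := by
  induction φ with
  | atom a x => simp [trc, freeSO]
  | le x y => simp [trc, freeSO]
  | mem x X => simp [trc, freeSO]
  | not φ ih => simpa [trc, freeSO] using ih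
  | and φ ψ ih1 ih2 =>
    simp only [trc, freeSO]
    rintro Y (h | h)
    exacts [Or.inl (ih1 _ h), Or.inr (ih2 _ h)]
  | exFO x φ ih => simpa [trc, freeSO] using ih
  | exSO X φ ih =>
    simp only [trc, freeSO]
    rintro Y ⟨h, h1⟩
    rcases h with h | h
    · exact absurd (infF_SO X h) h1
    exact ⟨ih _ h, h1⟩

theorem tr_sat {AP : Type} (K : KripkeTree AP) (φ : MSOL AP) :
    ∀ V1 V2 V2', (∀ X, V2 X = V2' (2 * X) ∩ V2' (2 * X + 1)) →
      (Sat MSOdom K V1 V2 φ ↔ Sat (coweakDom MSOdom) K V1 V2' (tr φ)) := by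
  induction φ with
  | atom a x => intros; simp [tr, Sat]
  | le x y => intros; simp [tr, Sat]
  | mem x X => intro V1 V2 V2' h; simp [tr, Sat, h]
  | not φ ih => intro V1 V2 V2' h; simp [tr, Sat, ih _ _ _ h]
  | and φ ψ ih1 ih2 => intro V1 V2 V2' h; simp [tr, Sat, ih1 _ _ _ h, ih2 _ _ _ h]
  | exFO x φ ih => intro V1 V2 V2' h; simp [tr, Sat, ih _ _ _ h]
  | exSO X φ ih =>
    intro V1 V2 V2' h
    have key : ∀ A B : Set Node, ∀ Y, Function.update V2 X (A ∩ B) Y =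
        (Function.update (Function.update V2' (2 * X) A) (2 * X + 1) B) (2 * Y) ∩
        (Function.update (Function.update V2' (2 * X) A) (2 * X + 1) B) (2 * Y + 1) := by
      intro A B Y
      by_cases hY : Y = X
      · subst hY; simp [Function.update_apply]
      · have h1 : 2 * Y ≠ 2 * X + 1 := by omega
        have h2 : 2 * Y + 1 ≠ 2 * X := by omega
        simp [Function.update_apply, hY, h1, h2, h]
    simp only [tr, Sat]
    constructor
    · rintro ⟨S, hS, hs⟩
      obtain ⟨A, B, hA, hA', hB, hB', rfl⟩ := split_infinite (infinite_T K) hS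
      exact ⟨A, ⟨hA, hA'⟩, B, ⟨hB, hB'⟩, (ih _ _ _ (key A B)).1 hs⟩
    · rintro ⟨A, ⟨hA, hA'⟩, B, ⟨hB, hB'⟩, hs⟩
      exact ⟨A ∩ B, fun x hx => hA hx.1, (ih _ _ _ (key A B)).2 hs⟩

theorem finF_sat {AP : Type} (K : KripkeTree AP) (X : ℕ) (V1 : ℕ → Node) (V2 : ℕ → Set Node)
    (h : V2 (2 * X) ⊆ K.T) :
    Sat (coweakDom MSOdom) K V1 V2 (finF X) ↔ (V2 (2 * X) ∩ V2 (2 * X + 1)).Finite := by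
  simp only [finF, Sat, Function.update_apply]
  simp only [Function.update_apply, if_true, show 2 * X ≠ 2 * X + 2 by omega,
    show 2 * X + 1 ≠ 2 * X + 2 by omega, if_false]
  constructor
  · intro h1
    by_contra h2
    refine h1 ⟨_, ⟨fun x hx => h hx.1, h2⟩, ?_⟩
    rintro ⟨τ, _, h3, h4⟩
    exact h4 h3
  · rintro h1 ⟨S, ⟨hS, hS'⟩, h2⟩
    apply hS'
    refine h1.subset fun x hx => ?_
    by_contra h3
    exact h2 ⟨x, hS hx, hx, h3⟩

theorem trw_sat {AP : Type} (K : KripkeTree AP) (φ : MSOL AP) :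
    ∀ V1 V2 V2', (∀ X, V2 X = V2' (2 * X) ∩ V2' (2 * X + 1)) →
      (Sat (weakDom MSOdom) K V1 V2 φ ↔ Sat (coweakDom MSOdom) K V1 V2' (trw φ)) := by
  induction φ with
  | atom a x => intros; simp [trw, Sat]
  | le x y => intros; simp [trw, Sat]
  | mem x X => intro V1 V2 V2' h; simp [trw, Sat, h]
  | not φ ih => intro V1 V2 V2' h; simp [trw, Sat, ih _ _ _ h]
  | and φ ψ ih1 ih2 => intro V1 V2 V2' h; simp [trw, Sat, ih1 _ _ _ h, ih2 _ _ _ h]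
  | exFO x φ ih => intro V1 V2 V2' h; simp [trw, Sat, ih _ _ _ h]
  | exSO X φ ih =>
    intro V1 V2 V2' h
    have key : ∀ A B : Set Node, ∀ Y, Function.update V2 X (A ∩ B) Y =
        (Function.update (Function.update V2' (2 * X) A) (2 * X + 1) B) (2 * Y) ∩
        (Function.update (Function.update V2' (2 * X) A) (2 * X + 1) B) (2 * Y + 1) := by
      intro A B Y
      by_cases hY : Y = X
      · subst hY; simp [Function.update_apply]
      · have h1 : 2 * Y ≠ 2 * X + 1 := by omega
        have h2 : 2 * Y + 1 ≠ 2 * X := by omega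
        simp [Function.update_apply, hY, h1, h2, h]
    simp only [trw, Sat]
    constructor
    · rintro ⟨S, ⟨hS, hSf⟩, hs⟩
      obtain ⟨A, B, hA, hA', hB, hB', rfl⟩ := split_infinite (infinite_T K) hS
      refine ⟨A, ⟨hA, hA'⟩, B, ⟨hB, hB'⟩, (finF_sat K X _ _ ?_).2 ?_, (ih _ _ _ (key A B)).1 hs⟩
      · simpa [Function.update_apply] using (show A ⊆ K.T from hA)
      · simpa [Function.update_apply] using hSf
    · rintro ⟨A, ⟨hA, hA'⟩, B, ⟨hB, hB'⟩, hf, hs⟩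
      have := (finF_sat K X _ _ (by simpa [Function.update_apply] using (show A ⊆ K.T from hA))).1 hf
      exact ⟨A ∩ B, ⟨fun x hx => hA hx.1, by simpa [Function.update_apply] using this⟩,
        (ih _ _ _ (key A B)).2 hs⟩

theorem infF_sat {AP : Type} (K : KripkeTree AP) (hK : FinBranching K.T) (X : ℕ)
    (V1 : ℕ → Node) (V2 : ℕ → Set Node) (h : V2 X ⊆ K.T) :
    Sat MSOdom K V1 V2 (infF X) ↔ (V2 X).Infinite := by
  have h0 : Sat MSOdom K V1 V2 (infF X) ↔ ∃ S ⊆ K.T, (∃ y ∈ K.T, y ∈ S) ∧ ∀ y ∈ K.T, y ∈ S →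
      (∃ z ∈ K.T, z ∈ S ∧ y <+: z ∧ ¬ z <+: y) ∧ ∃ x ∈ K.T, x ∈ V2 X ∧ y <+: x := by
    simp [infF, Sat, MSOdom, Function.update_apply]
    refine exists_congr fun S => and_congr_right fun hS => and_congr_right fun _ =>
      forall_congr' fun y => ⟨?_, ?_⟩
    · intro h hy hyS
      obtain ⟨z, hz, hzS, _, _, h1, h2, x, hx, hx1, hx2, _, hx3⟩ := h hy hyS
      exact ⟨⟨z, hz, hzS, h1, h2 hz hy⟩, ⟨x, hx, hx1, hx3⟩⟩
    · intro h hy hyS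
      obtain ⟨⟨z, hz, hzS, h1, h2⟩, ⟨x, hx, hx1, hx2⟩⟩ := h hy hyS
      exact ⟨z, hz, hzS, hy, hz, h1, fun _ _ => h2, x, hx, hx1, hy, hx, hx2⟩
  rw [h0]
  constructor
  · rintro ⟨S, hS, ⟨y, hyT, hy⟩, h2⟩ hfin
    obtain ⟨m, hm, hmax⟩ := Set.exists_max_image (V2 X) List.length hfin (by
      obtain ⟨x, _, hx, _⟩ := (h2 y hyT hy).2; exact ⟨x, hx⟩)
    have : ∀ n, ∃ z ∈ S, n ≤ z.length := by
      intro n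
      induction n with
      | zero => exact ⟨y, hy, Nat.zero_le _⟩
      | succ n ih =>
        obtain ⟨z, hz, hn⟩ := ih
        obtain ⟨w, hw, hwS, h3, h4⟩ := (h2 z (hS hz) hz).1
        refine ⟨w, hwS, ?_⟩
        by_contra hlt
        have hl := h3.length_le
        have := h3.eq_of_length (by omega)
        subst this
        exact h4 List.prefix_rfl
    obtain ⟨z, hz, hn⟩ := this (m.length + 1)
    obtain ⟨x, _, hx, hzx⟩ := (h2 z (hS hz) hz).2
    have := hmax x hx
    have := hzx.length_le
    omega
  · intro hinf
    refine ⟨{y | y ∈ K.T ∧ (V2 X ∩ {x | y <+: x}).Infinite}, fun y hy => hy.1,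
      ⟨K.root, K.rooted.1, K.rooted.1, ?_⟩, ?_⟩
    · rwa [Set.inter_eq_left.2]
      intro x hx; exact K.rooted.2.1 x (h hx)
    · rintro y hyT ⟨_, hy⟩
      refine ⟨?_, ?_⟩
      · by_contra hno
        push Not at hno
        apply hy
        have hfin : (⋃ z ∈ {τ' : Node | childIn K.T y τ'}, V2 X ∩ {x | z <+: x}).Finite := by
          refine (hK y hyT).biUnion ?_
          rintro z ⟨hz, n, rfl⟩
          by_contra hi
          have := hno _ hz ⟨hz, hi⟩ (List.prefix_append _ _)
          have := this.length_le
          simp at this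
        refine (hfin.union (Set.finite_singleton y)).subset ?_
        rintro x ⟨hx, t, rfl⟩
        cases t with
        | nil => right; simp
        | cons n t =>
          left
          have hz : y ++ [n] ∈ K.T := by
            obtain ⟨s, rfl⟩ := K.rooted.2.1 y hyT
            have := K.rooted.2.2 (s ++ n :: t) (s ++ [n]) (by simpa using h hx) (by simp)
            simpa using this
          simp only [Set.mem_iUnion]
          exact ⟨y ++ [n], ⟨hz, n, rfl⟩, hx, ⟨t, by simp⟩⟩
      · obtain ⟨x, hx, hx2⟩ := hy.nonempty
        exact ⟨x, h hx, hx, hx2⟩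

theorem trc_sat {AP : Type} (K : KripkeTree AP) (hK : FinBranching K.T) (φ : MSOL AP) :
    ∀ V1 V2, (Sat (coweakDom MSOdom) K V1 V2 φ ↔ Sat MSOdom K V1 V2 (trc φ)) := by
  induction φ with
  | atom a x => intros; simp [trc, Sat]
  | le x y => intros; simp [trc, Sat]
  | mem x X => intros; simp [trc, Sat]
  | not φ ih => intros; simp [trc, Sat, ih]
  | and φ ψ ih1 ih2 => intros; simp [trc, Sat, ih1, ih2]
  | exFO x φ ih => intros; simp [trc, Sat, ih]
  | exSO X φ ih =>
    intro V1 V2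
    simp only [trc, Sat, ih]
    constructor
    · rintro ⟨S, ⟨hS, hi⟩, hs⟩
      exact ⟨S, hS, (infF_sat K hK X _ _ (by simpa using (show S ⊆ K.T from hS))).2 (by simpa using hi), hs⟩
    · rintro ⟨S, hS, hi, hs⟩
      have := (infF_sat K hK X _ _ (by simpa using (show S ⊆ K.T from hS))).1 hi
      exact ⟨S, ⟨hS, by simpa using this⟩, hs⟩

theorem leq_MSO {AP : Type} (M : Set (KripkeTree AP)) : MLogic.Leq M (MSO AP) (CoWMSO AP) := by
  intro φ hφ _
  refine ⟨tr φ, ⟨by rw [tr_FO]; exact hφ.1, ?_⟩, trivial, fun K _ => ?_⟩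
  · rw [Set.eq_empty_iff_forall_notMem]
    intro Y hY
    have := tr_SO φ Y hY
    rw [hφ.2] at this
    exact this
  · constructor
    · rintro ⟨V1, V2, h⟩
      exact ⟨V1, fun n => V2 (n / 2), (tr_sat K φ V1 V2 _ (by
        intro X; simp [show (2 * X + 1) / 2 = X by omega])).1 h⟩
    · rintro ⟨V1, V2, h⟩
      exact ⟨V1, fun X => V2 (2 * X) ∩ V2 (2 * X + 1), (tr_sat K φ V1 _ _ fun _ => rfl).2 h⟩

theorem leq_WMSO {AP : Type} (M : Set (KripkeTree AP)) : MLogic.Leq M (WMSO AP) (CoWMSO AP) := by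
  intro φ hφ _
  refine ⟨trw φ, ⟨by rw [trw_FO]; exact hφ.1, ?_⟩, trivial, fun K _ => ?_⟩
  · rw [Set.eq_empty_iff_forall_notMem]
    intro Y hY
    have := trw_SO φ Y hY
    rw [hφ.2] at this
    exact this
  · constructor
    · rintro ⟨V1, V2, h⟩
      exact ⟨V1, fun n => V2 (n / 2), (trw_sat K φ V1 V2 _ (by
        intro X; simp [show (2 * X + 1) / 2 = X by omega])).1 h⟩
    · rintro ⟨V1, V2, h⟩
      exact ⟨V1, fun X => V2 (2 * X) ∩ V2 (2 * X + 1), (trw_sat K φ V1 _ _ fun _ => rfl).2 h⟩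

theorem leq_CoWMSO {AP : Type} : MLogic.Leq (finBrKT AP) (CoWMSO AP) (MSO AP) := by
  intro φ hφ _
  refine ⟨trc φ, ⟨by rw [trc_FO]; exact hφ.1, ?_⟩, trivial, fun K hK => ?_⟩
  · rw [Set.eq_empty_iff_forall_notMem]
    intro Y hY
    have := trc_SO φ Y hY
    rw [hφ.2] at this
    exact this
  · exact exists_congr fun V1 => exists_congr fun V2 => trc_sat K hK φ V1 V2

theorem sat_congr {AP : Type} (D : SODom) (K : KripkeTree AP) (φ : MSOL AP) :
    ∀ V1 V2 V1' V2', (∀ x ∈ φ.freeFO, V1 x = V1' x) → (∀ X ∈ φ.freeSO, V2 X = V2' X) →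
      (Sat D K V1 V2 φ ↔ Sat D K V1' V2' φ) := by
  induction φ with
  | atom a x => intro V1 V2 V1' V2' h1 h2; simp [freeFO] at h1; simp [Sat, h1]
  | le x y => intro V1 V2 V1' V2' h1 h2; simp [freeFO] at h1; simp [Sat, h1]
  | mem x X =>
    intro V1 V2 V1' V2' h1 h2; simp [freeFO] at h1; simp [freeSO] at h2; simp [Sat, h1, h2]
  | not φ ih => intro V1 V2 V1' V2' h1 h2; simp only [Sat]; rw [ih _ _ _ _ h1 h2]
  | and φ ψ ih1 ih2 =>
    intro V1 V2 V1' V2' h1 h2; simp only [Sat]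
    rw [ih1 _ _ _ _ (fun x hx => h1 x (Or.inl hx)) (fun x hx => h2 x (Or.inl hx)),
      ih2 _ _ _ _ (fun x hx => h1 x (Or.inr hx)) (fun x hx => h2 x (Or.inr hx))]
  | exFO x φ ih =>
    intro V1 V2 V1' V2' h1 h2; simp only [Sat]
    refine exists_congr fun τ => and_congr_right fun _ => ih _ _ _ _ ?_ h2
    intro y hy
    by_cases hyx : y = x
    · subst hyx; simp
    · simp [Function.update_apply, hyx]; exact h1 y ⟨hy, hyx⟩
  | exSO x φ ih =>
    intro V1 V2 V1' V2' h1 h2; simp only [Sat]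
    refine exists_congr fun τ => and_congr_right fun _ => ih _ _ _ _ h1 ?_
    intro y hy
    by_cases hyx : y = x
    · subst hyx; simp
    · simp [Function.update_apply, hyx]; exact h2 y ⟨hy, hyx⟩

theorem ksat_iff {AP : Type} (L : MLogic AP) (K : KripkeTree AP) (φ : MSOL AP)
    (h : φ.IsSentence) (V1 : ℕ → Node) (V2 : ℕ → Set Node) :
    L.KSat K φ ↔ Sat L.dom K V1 V2 φ := by
  constructor
  · rintro ⟨W1, W2, hs⟩
    exact (sat_congr _ _ _ _ _ _ _ (by simp [h.1]) (by simp [h.2])).1 hs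
  · intro hs; exact ⟨_, _, hs⟩


/-! ## A non-Borel set -/

/-- Initial segments. -/
def pre (y : ℕ → Bool) (n : ℕ) : List Bool := List.ofFn (fun i : Fin n => y i)

theorem pre_length (y : ℕ → Bool) (n : ℕ) : (pre y n).length = n := by simp [pre]

theorem pre_eq_iff (y y' : ℕ → Bool) (n : ℕ) : pre y n = pre y' n ↔ ∀ i < n, y i = y' i := by
  simp [pre, List.ofFn_inj, funext_iff, Fin.forall_iff]

theorem cont_lemma {g : (ℕ → ℕ) → (ℕ → Bool)} (hg : Continuous g) (z : ℕ → ℕ) (i : ℕ) :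
    ∃ n, ∀ z' : ℕ → ℕ, (∀ k < n, z' k = z k) → g z' i = g z i := by
  have ho : IsOpen {z' | g z' i = g z i} :=
    (isOpen_discrete {g z i}).preimage ((continuous_apply i).comp hg)
  obtain ⟨s, ⟨x, n, rfl⟩, hz, hs⟩ :=
    (PiNat.isTopologicalBasis_cylinders (fun _ : ℕ => ℕ)).exists_subset_of_mem_open
      (show z ∈ {z' | g z' i = g z i} from rfl) ho
  refine ⟨n, fun z' hz' => hs ?_⟩
  rw [PiNat.mem_cylinder_iff] at hz ⊢
  intro k hk
  rw [hz' k hk, hz k hk]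

/-- enumeration of the ones. -/
noncomputable def en (y : ℕ → Bool) (k : ℕ) : ℕ := Nat.nth (fun i => y i = true) k

noncomputable def hh (y : ℕ → Bool) (k : ℕ) : ℕ := en y (k + 1) - en y k - 1

theorem en_local (y : ℕ → Bool) (hy : {i | y i = true}.Infinite) (k : ℕ) (y' : ℕ → Bool)
    (h : ∀ i < en y k + 1, y i = y' i) : en y' k = en y k := by
  have h1 : y (en y k) = true := Nat.nth_mem_of_infinite hy k
  have h2 : Nat.count (fun i => y i = true) (en y k) = k := Nat.count_nth_of_infinite hy k
  have h3 : Nat.count (fun i => y' i = true) (en y k) = k := by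
    rw [← h2, h2, Nat.count_eq_card_filter_range]
    rw [Nat.count_eq_card_filter_range] at h2
    rw [← h2, h2]
    nth_rewrite 2 [← h2]
    congr 1
    apply Finset.filter_congr
    intro i hi
    rw [h i (by have := Finset.mem_range.1 hi; omega)]
  have h4 : y' (en y k) = true := by rw [← h _ (by omega)]; exact h1
  have := Nat.nth_count (p := fun i => y' i = true) h4
  rw [h3] at this
  exact this

theorem hh_surj (z : ℕ → ℕ) : ∃ y : ℕ → Bool, {i | y i = true}.Infinite ∧ hh y = z := by
  classical
  let e : ℕ → ℕ := fun k => ∑ i ∈ Finset.range k, (z i + 1)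
  have he : StrictMono e := strictMono_nat_of_lt_succ fun k => by
    simp only [e, Finset.sum_range_succ]; omega
  let y : ℕ → Bool := fun i => decide (i ∈ Set.range e)
  have hy : {i | y i = true} = Set.range e := by ext i; simp [y]
  have hinf : {i | y i = true}.Infinite := by
    rw [hy]; exact Set.infinite_range_of_injective he.injective
  have hen : en y = e := by
    have h1 : StrictMono (en y) := Nat.nth_strictMono hinf
    refine (StrictMono.range_inj h1 he).1 ?_
    rw [← hy]
    exact Nat.range_nth_of_infinite hinf
  refine ⟨y, hinf, ?_⟩
  funext k
  simp only [hh, hen, e, Finset.sum_range_succ]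
  omega

theorem not_borel : ¬ MeasurableSet {c : ℕ → Bool | ∃ y : ℕ → Bool,
    {n | c (Encodable.encode (pre c n, pre y n)) = true}.Infinite} := by
  classical
  intro hm
  have hpb : PolishSpace Bool := by
    have hc : Topology.IsClosedEmbedding Bool.toNat :=
      Topology.IsClosedEmbedding.of_continuous_injective_isClosedMap
        continuous_of_discreteTopology (by intro a b; cases a <;> cases b <;> simp)
        (fun _ _ => isClosed_discrete _)
    exact hc.polishSpace
  have ha := hm.compl.analyticSet
  rw [MeasureTheory.AnalyticSet] at ha
  suffices ∃ R : List Bool × List Bool → Prop, ∀ c : ℕ → Bool,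
      (¬ ∃ y : ℕ → Bool, {n | c (Encodable.encode (pre c n, pre y n)) = true}.Infinite) ↔
      ∃ y : ℕ → Bool, {n | R (pre c n, pre y n)}.Infinite by
    obtain ⟨R, hR⟩ := this
    let c0 : ℕ → Bool := fun k => decide (∃ p, k = Encodable.encode p ∧ R p)
    have hc : ∀ p : List Bool × List Bool, c0 (Encodable.encode p) = true ↔ R p := by
      intro p
      simp only [c0, decide_eq_true_eq]
      constructor
      · rintro ⟨q, hq, h⟩
        rwa [Encodable.encode_injective hq]
      · intro h; exact ⟨p, rfl, h⟩
    have := hR c0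
    simp only [hc] at this
    tauto
  rcases ha with ha | ⟨g, hg, hr⟩
  · refine ⟨fun _ => False, fun c => ?_⟩
    have : c ∉ ({c : ℕ → Bool | ∃ y : ℕ → Bool,
      {n | c (Encodable.encode (pre c n, pre y n)) = true}.Infinite}ᶜ : Set _) := by
      rw [ha]; simp
    simpa using this
  · refine ⟨fun p => ∃ y', pre y' p.2.length = p.2 ∧ (∃ m, p.2.length = m + 1 ∧ y' m = true) ∧
      pre (g (hh y')) p.2.length = p.1, fun c => ?_⟩
    have h1 : (¬ ∃ y : ℕ → Bool,
        {n | c (Encodable.encode (pre c n, pre y n)) = true}.Infinite) ↔ c ∈ Set.range g := by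
      rw [hr]; simp
    rw [h1]
    simp only [pre_length]
    constructor
    · rintro ⟨z, rfl⟩
      obtain ⟨y, hy, rfl⟩ := hh_surj z
      refine ⟨y, (hy.image (f := fun m => m + 1) (by intro a _ b _ h; simpa using h)).mono ?_⟩
      rintro _ ⟨m, hm, rfl⟩
      exact ⟨y, rfl, ⟨m, rfl, hm⟩, rfl⟩
    · rintro ⟨y, hN⟩
      have hy : {i | y i = true}.Infinite := by
        rw [Set.infinite_iff_exists_gt] at hN ⊢
        intro a
        obtain ⟨n, ⟨y', h1, ⟨m, rfl, h2⟩, h3⟩, hn⟩ := hN (a + 1)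
        rw [pre_eq_iff] at h1
        exact ⟨m, by rw [Set.mem_setOf_eq, ← h1 m (by omega)]; exact h2, by omega⟩
      refine ⟨hh y, ?_⟩
      funext i
      obtain ⟨K, hK⟩ := cont_lemma hg (hh y) i
      rw [Set.infinite_iff_exists_gt] at hN
      obtain ⟨n, ⟨y', h1, _, h3⟩, hn⟩ := hN (en y K + 1 + i)
      rw [pre_eq_iff] at h1 h3
      rw [← h3 i (by omega)]
      symm
      apply hK
      have hmono : StrictMono (en y) := Nat.nth_strictMono hy
      have : ∀ k ≤ K, en y' k = en y k := by
        intro k hk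
        apply en_local y hy
        intro j hj
        have := hmono.monotone hk
        exact (h1 j (by omega)).symm
      intro k hk
      rw [hh, hh, this _ (by omega), this _ (by omega)]

theorem meas_sat {AP : Type} (K : (ℕ → Bool) → KripkeTree AP)
    (hT : ∀ τ, MeasurableSet {c | τ ∈ (K c).T}) (hL : ∀ c τ, (K c).Lab τ = ∅) (φ : MSOL AP) :
    ∀ V1 V2, MeasurableSet {c | Sat (weakDom MSOdom) (K c) V1 V2 φ} := by
  induction φ with
  | atom a x => intro V1 V2; simp [Sat, hL]
  | le x y =>
    intro V1 V2
    simp only [Sat]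
    exact (hT _).inter ((hT _).inter (MeasurableSet.const _))
  | mem x X => intro V1 V2; simp only [Sat]; exact MeasurableSet.const _
  | not φ ih => intro V1 V2; simp only [Sat]; exact (ih V1 V2).compl
  | and φ ψ ih1 ih2 => intro V1 V2; simp only [Sat]; exact (ih1 V1 V2).inter (ih2 V1 V2)
  | exFO x φ ih =>
    intro V1 V2
    have : {c | Sat (weakDom MSOdom) (K c) V1 V2 (.exFO x φ)} =
      ⋃ τ : Node, {c | τ ∈ (K c).T} ∩
        {c | Sat (weakDom MSOdom) (K c) (Function.update V1 x τ) V2 φ} := by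
      ext c; simp [Sat]
    rw [this]
    exact MeasurableSet.iUnion fun τ => (hT τ).inter (ih _ _)
  | exSO X φ ih =>
    intro V1 V2
    have : {c | Sat (weakDom MSOdom) (K c) V1 V2 (.exSO X φ)} =
      ⋃ S : Finset Node, (⋂ τ ∈ S, {c | τ ∈ (K c).T}) ∩
        {c | Sat (weakDom MSOdom) (K c) V1 (Function.update V2 X (S : Set Node)) φ} := by
      ext c
      simp only [Sat, weakDom, MSOdom, Set.mem_setOf_eq, Set.mem_iUnion, Set.mem_inter_iff,
        Set.mem_iInter]
      constructor
      · rintro ⟨S, ⟨hS, hf⟩, h⟩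
        refine ⟨hf.toFinset, fun τ hτ => hS (by simpa using hτ), by simpa using h⟩
      · rintro ⟨S, hS, h⟩
        exact ⟨S, ⟨fun τ hτ => hS τ (by simpa using hτ), S.finite_toSet⟩, h⟩
    rw [this]
    exact MeasurableSet.iUnion fun S =>
      (MeasurableSet.biInter S.countable_toSet fun τ _ => hT τ).inter (ih _ _)

/-- The marked binary tree. -/
def TM (M : Set (List Bool)) : Set Node :=
  {τ | ∃ (u : List Bool) (k : ℕ), τ = u.map Bool.toNat ++ List.replicate k 2 ∧ (k = 0 ∨ u ∈ M)}

theorem map_no2 (u : List Bool) : 2 ∉ u.map Bool.toNat := by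
  simp only [List.mem_map, not_exists, not_and]
  rintro b - h
  cases b <;> simp at h

theorem TM_snoc {M : Set (List Bool)} {a : Node} {n : ℕ} (h : a ++ [n] ∈ TM M) :
    a ∈ TM M ∧ (2 ∈ a → n = 2) ∧ n < 3 := by
  obtain ⟨u, k, h1, h2⟩ := h
  cases k with
  | zero =>
    rcases List.eq_nil_or_concat u with rfl | ⟨u', b, rfl⟩
    · simp at h1
    · simp at h1
      obtain ⟨rfl, rfl⟩ := h1
      refine ⟨⟨u', 0, by simp, Or.inl rfl⟩, fun h => absurd h (map_no2 u'), ?_⟩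
      cases b <;> simp
  | succ k =>
    rw [List.replicate_succ', ← List.append_assoc] at h1
    obtain ⟨rfl, h3⟩ := List.append_inj' h1 rfl
    simp at h3
    subst h3
    exact ⟨⟨u, k, rfl, Or.inr (by simpa using h2)⟩, fun _ => rfl, by omega⟩

theorem TM_pref {M : Set (List Bool)} (a t : Node) : a ++ t ∈ TM M → a ∈ TM M := by
  induction t using List.reverseRecOn with
  | nil => simp
  | append_singleton t n ih =>
    intro h
    rw [← List.append_assoc] at h
    exact ih (TM_snoc h).1

theorem TM_ext {M : Set (List Bool)} (a t : Node) (h2 : 2 ∈ a) :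
    a ++ t ∈ TM M → ∃ j, t = List.replicate j 2 := by
  induction t using List.reverseRecOn with
  | nil => intro _; exact ⟨0, rfl⟩
  | append_singleton t n ih =>
    intro h
    rw [← List.append_assoc] at h
    obtain ⟨h3, h4, _⟩ := TM_snoc h
    obtain ⟨j, rfl⟩ := ih h3
    refine ⟨j + 1, ?_⟩
    rw [List.replicate_succ', h4 (by simp [h2])]

/-- The marked binary Kripke tree. -/
def KM (AP : Type) (M : Set (List Bool)) : KripkeTree AP where
  T := TM M
  root := []
  rooted := ⟨⟨[], 0, rfl, Or.inl rfl⟩, fun τ _ => List.nil_prefix, by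
    rintro σ σ' h ⟨t, rfl⟩
    exact TM_pref σ' t h⟩
  nonblocking := by
    rintro τ ⟨u, k, rfl, hk⟩
    cases k with
    | zero => exact ⟨0, u ++ [false], 0, by simp, Or.inl rfl⟩
    | succ k => exact ⟨2, u, k + 2, by simp [List.replicate_succ'], Or.inr (by simpa using hk)⟩
  Lab := fun _ => ∅

theorem KM_fin (AP : Type) (M : Set (List Bool)) : KM AP M ∈ finBrKT AP := by
  intro τ _
  refine ((Set.finite_lt_nat 3).image (fun n => τ ++ [n])).subset ?_
  rintro _ ⟨h, n, rfl⟩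
  exact ⟨n, (TM_snoc h).2.2, rfl⟩

/-- linear above `x`. -/
def Lin (T : Set Node) (x : Node) : Prop :=
  ∀ y ∈ T, ∀ z ∈ T, x <+: y → x <+: z → y <+: z ∨ z <+: y

def Mk (T : Set Node) (x : Node) : Prop :=
  ¬ Lin T x ∧ ∃ y ∈ T, x <+: y ∧ Lin T y ∧ ∀ w ∈ T, x <+: w → w <+: y → w <+: x ∨ Lin T w

def linF {AP : Type} (x : ℕ) : MSOL AP :=
  .not (.exFO 3 (.exFO 4 (.and (.and (.le x 3) (.le x 4)) (.and (.not (.le 3 4)) (.not (.le 4 3))))))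

def mkF {AP : Type} : MSOL AP :=
  .and (.not (linF 0)) (.exFO 1 (.and (.le 0 1) (.and (linF 1)
    (.not (.exFO 2 (.and (.and (.le 0 2) (.le 2 1)) (.and (.not (.le 2 0)) (.not (linF 2)))))))))

def psi {AP : Type} : MSOL AP :=
  .exSO 0 (.not (.exFO 0 (.and (.mem 0 0) (.not (.and mkF
    (.not (.exFO 1 (.and (.mem 1 0) (.and (.not (.le 0 1)) (.not (.le 1 0)))))))))))

theorem psi_sentence {AP : Type} : (psi : MSOL AP).IsSentence := by
  constructor
  · ext y; simp [psi, mkF, linF, freeFO]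
    try tauto
  · ext y; simp [psi, mkF, linF, freeSO]

theorem linF_sat {AP : Type} (D : SODom) (K : KripkeTree AP) (V1 V2) (x : ℕ) (hx : x < 3)
    (hV : V1 x ∈ K.T) : Sat D K V1 V2 (linF x) ↔ Lin K.T (V1 x) := by
  have h3 : x ≠ 3 := by omega
  have h4 : x ≠ 4 := by omega
  simp only [linF, Sat, Lin, Function.update_apply]
  simp [h3, h4, hV]
  constructor
  · intro h y hy z hz h1 h2
    by_contra h5
    push Not at h5
    exact h5.2 (h y hy z hz hy h1 hz h2 (fun _ _ => h5.1)).2.2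
  · intro h y hy z hz _ h1 _ h2 h5
    rcases h y hy z hz h1 h2 with h6 | h6
    · exact absurd h6 (h5 hy hz)
    · exact ⟨hz, hy, h6⟩

theorem mkF_sat {AP : Type} (D : SODom) (K : KripkeTree AP) (V1 V2)
    (hV : V1 0 ∈ K.T) : Sat D K V1 V2 mkF ↔ Mk K.T (V1 0) := by
  simp only [mkF, Sat, Mk]
  refine and_congr (not_congr (linF_sat D K V1 V2 0 (by omega) hV)) ?_
  refine exists_congr fun y => and_congr_right fun hy => ?_
  rw [linF_sat D K _ V2 1 (by omega) (by simpa using hy)]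
  refine and_congr (by simp [hy, hV]) (and_congr (by simp) ?_)
  simp only [not_exists, not_and]
  refine forall_congr' fun w => forall_congr' fun hw => ?_
  rw [linF_sat D K _ V2 2 (by omega) (by simpa using hw)]
  simp [hy, hw, hV]
  by_cases h : w <+: V1 0 <;> simp [h]

theorem psi_sat {AP : Type} (K : KripkeTree AP) (V1 V2) :
    Sat (coweakDom MSOdom) K V1 V2 psi ↔ ∃ S ⊆ K.T, S.Infinite ∧ ∀ x ∈ S, Mk K.T x ∧
      ∀ y ∈ S, x <+: y ∨ y <+: x := by
  simp only [psi, Sat, coweakDom, MSOdom, Set.mem_setOf_eq, and_assoc]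
  refine exists_congr fun S => and_congr_right fun hS => and_congr_right fun _ => ?_
  constructor
  · intro h0 x hx
    have h : ∀ x, x ∈ K.T → _ := fun x hx h1 => not_not.1 (fun h2 => h0 ⟨x, hx, h1, h2⟩)
    have := h x (hS hx) (by simpa using hx)
    rw [mkF_sat _ _ _ _ (by simpa using hS hx)] at this
    refine ⟨by simpa using this.1, fun y hy => ?_⟩
    by_contra h3
    push Not at h3
    refine this.2 ⟨y, hS hy, by simpa using hy, ?_⟩
    simp [h3]
  · rintro h ⟨x, hxT, hx, hn⟩
    apply hn
    have hx : x ∈ S := by simpa using hx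
    rw [mkF_sat _ _ _ _ (by simpa using hS hx)]
    refine ⟨by simpa using (h x hx).1, ?_⟩
    rintro ⟨y, hyT, hy, h3, h4⟩
    have hy : y ∈ S := by simpa using hy
    have h2 := (h x hx).2 y hy
    simp [hxT, hyT] at h3 h4
    tauto

theorem lin_iff {M : Set (List Bool)} {x : Node} (hx : x ∈ TM M) : Lin (TM M) x ↔ 2 ∈ x := by
  constructor
  · intro h
    by_contra h2
    obtain ⟨u, k, rfl, hk⟩ := hx
    have hk0 : k = 0 := by
      by_contra h0; exact h2 (by simp [h0])
    subst hk0
    have := h ((u ++ [false]).map Bool.toNat) ⟨u ++ [false], 0, by simp, Or.inl rfl⟩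
      ((u ++ [true]).map Bool.toNat) ⟨u ++ [true], 0, by simp, Or.inl rfl⟩ (by simp) (by simp)
    rcases this with h | h
    · have := h.eq_of_length (by simp)
      simp at this
    · have := h.eq_of_length (by simp)
      simp at this
  · rintro h y hy z hz ⟨t, rfl⟩ ⟨s, rfl⟩
    obtain ⟨j, rfl⟩ := TM_ext _ _ h hy
    obtain ⟨i, rfl⟩ := TM_ext _ _ h hz
    rcases le_total i j with hij | hij
    · right
      obtain ⟨d, rfl⟩ := Nat.exists_eq_add_of_le hij
      exact ⟨List.replicate d 2, by simp⟩
    · left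
      obtain ⟨d, rfl⟩ := Nat.exists_eq_add_of_le hij
      exact ⟨List.replicate d 2, by simp⟩

theorem toNat_inj : Function.Injective Bool.toNat := by
  intro a b h; cases a <;> cases b <;> simp_all

theorem mk_iff {M : Set (List Bool)} {x : Node} (hx : x ∈ TM M) :
    Mk (TM M) x ↔ ∃ u ∈ M, x = u.map Bool.toNat := by
  constructor
  · rintro ⟨h1, y, hy, hxy, hl, hw⟩
    rw [lin_iff hx] at h1
    rw [lin_iff hy] at hl
    obtain ⟨u, k, rfl, hk⟩ := hy
    have hk0 : k ≠ 0 := by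
      rintro rfl
      exact map_no2 u (by simpa using hl)
    have huM : u ∈ M := by tauto
    have hwT : u.map Bool.toNat ∈ TM M := ⟨u, 0, by simp, Or.inl rfl⟩
    refine ⟨u, huM, ?_⟩
    have hpre : x <+: u.map Bool.toNat := by
      rcases List.prefix_or_prefix_of_prefix hxy (List.prefix_append _ _) with h | ⟨t, rfl⟩
      · exact h
      · rw [List.prefix_append_right_inj] at hxy
        cases t with
        | nil => simp
        | cons a t =>
          exfalso
          apply h1
          have := hxy.subset (List.mem_cons_self (a := a) (l := t))
          have := List.eq_of_mem_replicate this
          simp [this]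
    rcases hw _ hwT hpre (List.prefix_append _ _) with h | h
    · exact hpre.eq_of_length (le_antisymm hpre.length_le h.length_le)
    · exact absurd ((lin_iff hwT).1 h) (map_no2 u)
  · rintro ⟨u, hu, rfl⟩
    have hyT : u.map Bool.toNat ++ [2] ∈ TM M := ⟨u, 1, by simp, Or.inr hu⟩
    refine ⟨by rw [lin_iff hx]; exact map_no2 u, u.map Bool.toNat ++ [2], hyT, by simp, ?_, ?_⟩
    · rw [lin_iff hyT]; simp
    · rintro w hw ⟨t, rfl⟩ h2
      rw [List.prefix_append_right_inj] at h2
      cases t with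
      | nil => left; simp
      | cons a t =>
        right
        rw [lin_iff hw]
        have := h2.subset (List.mem_cons_self (a := a) (l := t))
        simp at this
        simp [this]

theorem path_of_inf (M : Set (List Bool)) (S : Set (List Bool)) (hSM : S ⊆ M) (hS : S.Infinite)
    (hc : ∀ x ∈ S, ∀ y ∈ S, x <+: y ∨ y <+: x) : ∃ y, {n | pre y n ∈ M}.Infinite := by
  have hinj : Set.InjOn List.length S := by
    intro x hx y hy h
    rcases hc x hx y hy with h1 | h1
    · exact h1.eq_of_length h
    · exact (h1.eq_of_length h.symm).symm
  have hinf := hS.image hinj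
  have hex : ∀ n, ∃ u ∈ S, n < u.length := by
    intro n
    rw [Set.infinite_iff_exists_gt] at hinf
    obtain ⟨_, ⟨u, hu, rfl⟩, h⟩ := hinf n
    exact ⟨u, hu, h⟩
  choose f hf hlen using hex
  refine ⟨fun n => (f n)[n]'(hlen n), hinf.mono ?_⟩
  rintro _ ⟨u, hu, rfl⟩
  have : pre (fun n => (f n)[n]'(hlen n)) u.length = u := by
    apply List.ext_getElem (by simp [pre])
    intro i h1 h2
    simp only [pre, List.getElem_ofFn]
    rcases hc _ hu _ (hf i) with h | h
    · exact (h.getElem h2).symm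
    · exact h.getElem (hlen i)
  rw [Set.mem_setOf_eq, this]
  exact hSM hu

theorem psi_KM {AP : Type} (M : Set (List Bool)) (V1 V2) :
    Sat (coweakDom MSOdom) (KM AP M) V1 V2 psi ↔ ∃ y, {n | pre y n ∈ M}.Infinite := by
  rw [psi_sat]
  constructor
  · rintro ⟨S, hS, hi, h⟩
    refine path_of_inf M {u | u ∈ M ∧ u.map Bool.toNat ∈ S} (fun u hu => hu.1) ?_ ?_
    · intro hf
      apply hi
      refine (hf.image (List.map Bool.toNat)).subset ?_
      intro x hx
      obtain ⟨u, hu, rfl⟩ := (mk_iff (hS hx)).1 (h x hx).1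
      exact ⟨u, ⟨hu, hx⟩, rfl⟩
    · rintro u ⟨_, hu⟩ v ⟨_, hv⟩
      have := (h _ hu).2 _ hv
      rwa [List.prefix_map_iff_of_injective toNat_inj,
        List.prefix_map_iff_of_injective toNat_inj] at this
  · rintro ⟨y, hy⟩
    have hT : ∀ u : List Bool, u.map Bool.toNat ∈ TM M := fun u => ⟨u, 0, by simp, Or.inl rfl⟩
    refine ⟨(fun n => (pre y n).map Bool.toNat) '' {n | pre y n ∈ M}, ?_, ?_, ?_⟩
    · rintro _ ⟨n, hn, rfl⟩
      exact hT _
    · refine hy.image ?_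
      intro a _ b _ h
      simpa [pre_length] using congrArg List.length h
    · rintro _ ⟨n, hn, rfl⟩
      refine ⟨(mk_iff (hT _)).2 ⟨_, hn, rfl⟩, ?_⟩
      rintro _ ⟨m, hm, rfl⟩
      have key : ∀ a b, a ≤ b → pre y a <+: pre y b := by
        intro a b hab
        have : pre y a = (pre y b).take a := by
          apply List.ext_getElem (by simp [pre, hab])
          intro i h1 h2
          simp [pre]
        rw [this]
        exact List.take_prefix _ _
      simp only [List.prefix_map_iff_of_injective toNat_inj]
      rcases le_total n m with h | h
      · exact Or.inl (key _ _ h)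
      · exact Or.inr (key _ _ h)

/-- marks coded by `c`. -/
def Mc (c : ℕ → Bool) : Set (List Bool) :=
  {u | c (Encodable.encode (pre c u.length, u)) = true}

theorem meas_Mc (u : List Bool) : MeasurableSet {c | u ∈ Mc c} := by
  have : {c | u ∈ Mc c} = ⋃ t : Fin u.length → Bool,
      (⋂ i : Fin u.length, {c : ℕ → Bool | c i = t i}) ∩
        {c | c (Encodable.encode (List.ofFn t, u)) = true} := by
    ext c
    simp only [Mc, Set.mem_setOf_eq, Set.mem_iUnion, Set.mem_inter_iff, Set.mem_iInter]
    constructor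
    · intro h; exact ⟨fun i => c i, fun _ => rfl, h⟩
    · rintro ⟨t, h1, h2⟩
      have : t = fun i : Fin u.length => c i := by funext i; exact (h1 i).symm
      subst this
      exact h2
  rw [this]
  have hb : ∀ (i : ℕ) (b : Bool), MeasurableSet {c : ℕ → Bool | c i = b} := fun i b =>
    measurable_pi_apply (X := fun _ : ℕ => Bool) i (MeasurableSet.singleton b)
  exact MeasurableSet.iUnion fun t => (MeasurableSet.iInter fun i => hb _ _).inter (hb _ _)

theorem not_leq_WMSO {AP : Type} : ¬ MLogic.Leq (finBrKT AP) (CoWMSO AP) (WMSO AP) := by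
  intro h
  obtain ⟨φ, hφ, -, hK⟩ := h psi psi_sentence trivial
  apply not_borel
  have hm := meas_sat (fun c => KM AP (Mc c)) (fun τ => by
    have : {c | τ ∈ (KM AP (Mc c)).T} = ⋃ (u : List Bool) (k : ℕ),
        {c | τ = u.map Bool.toNat ++ List.replicate k 2} ∩ ({c | k = 0} ∪ {c | u ∈ Mc c}) := by
      ext c
      simp only [KM, TM, Set.mem_setOf_eq, Set.mem_iUnion, Set.mem_inter_iff, Set.mem_union]
    rw [this]
    exact MeasurableSet.iUnion fun u => MeasurableSet.iUnion fun k =>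
      (MeasurableSet.const _).inter ((MeasurableSet.const _).union (meas_Mc u)))
    (fun _ _ => rfl) φ (fun _ => []) (fun _ => ∅)
  convert hm using 2
  funext c
  have h1 := hK (KM AP (Mc c)) (KM_fin _ _)
  rw [ksat_iff _ _ _ psi_sentence (fun _ => []) (fun _ => ∅),
    ksat_iff _ _ _ hφ (fun _ => []) (fun _ => ∅)] at h1
  apply propext
  refine Iff.trans ?_ h1
  refine Iff.trans ?_ (psi_KM _ _ _).symm
  simp [Mc, pre_length]


/-! ### Part C -/

def Ty (W : Type) : ℕ → Type
  | 0 => W → W → Prop × Prop × Prop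
  | k + 1 => Ty W k × (W → Set (Ty W k))

theorem finite_Ty (W : Type) [Finite W] : ∀ k, Finite (Ty W k)
  | 0 => by unfold Ty; infer_instance
  | k + 1 => by
    have := finite_Ty W k
    unfold Ty
    infer_instance

open Classical in
noncomputable def tp {W : Type} : (k : ℕ) → (W → Set ℕ) → Ty W k
  | 0, s => fun w w' => (∃ p, p ∈ s w ∧ p ∈ s w', ∃ p ∈ s w, ∃ q ∈ s w', p ≤ q, (s w).Subsingleton)
  | k + 1, s => (tp k s, fun w => Set.range fun A => tp k (Function.update s w A))

theorem tp_zero {W : Type} : ∀ (k : ℕ) (s s' : W → Set ℕ), tp k s = tp k s' → tp 0 s = tp 0 s'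
  | 0, _, _, h => h
  | k + 1, s, s', h => by
    simp only [tp] at h
    exact tp_zero k s s' (Prod.ext_iff.1 h).1

theorem tp_f1 {W : Type} {k : ℕ} {s s' : W → Set ℕ} (h : tp k s = tp k s') (w w' : W) :
    (∃ p, p ∈ s w ∧ p ∈ s w') ↔ (∃ p, p ∈ s' w ∧ p ∈ s' w') := by
  have := congrFun (congrFun (tp_zero k s s' h) w) w'
  simp only [tp, Prod.mk.injEq] at this
  exact iff_of_eq this.1

theorem tp_f2 {W : Type} {k : ℕ} {s s' : W → Set ℕ} (h : tp k s = tp k s') (w w' : W) :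
    (∃ p ∈ s w, ∃ q ∈ s w', p ≤ q) ↔ (∃ p ∈ s' w, ∃ q ∈ s' w', p ≤ q) := by
  have := congrFun (congrFun (tp_zero k s s' h) w) w'
  simp only [tp, Prod.mk.injEq] at this
  exact iff_of_eq this.2.1

theorem tp_f3 {W : Type} {k : ℕ} {s s' : W → Set ℕ} (h : tp k s = tp k s') (w : W) :
    (s w).Subsingleton ↔ (s' w).Subsingleton := by
  have := congrFun (congrFun (tp_zero k s s' h) w) w
  simp only [tp, Prod.mk.injEq] at this
  exact iff_of_eq this.2.2

noncomputable def thr (W : Type) : ℕ → ℕ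
  | 0 => 2
  | k + 1 => Nat.card (Ty W k) * thr W k

theorem thr_two (W : Type) [Finite W] : ∀ k, 2 ≤ thr W k
  | 0 => le_refl _
  | k + 1 => by
    have := finite_Ty W k
    have : Nonempty (Ty W k) := ⟨tp k fun _ => ∅⟩
    have h1 : 0 < Nat.card (Ty W k) := Nat.card_pos
    have h2 := thr_two W k
    simp only [thr]
    nlinarith

/-- equal cardinality up to `t` -/
def Eqt (t : ℕ) (A B : Set ℕ) : Prop := min A.encard t = min B.encard t

theorem Eqt.symm {t : ℕ} {A B : Set ℕ} (h : Eqt t A B) : Eqt t B A := Eq.symm h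

theorem Eqt.le {t : ℕ} {A B : Set ℕ} (h : Eqt t A B) {s : ℕ} (hs : s ≤ t)
    (ha : (s : ℕ∞) ≤ A.encard) : (s : ℕ∞) ≤ B.encard := by
  have : (s : ℕ∞) ≤ min A.encard t := le_min ha (by exact_mod_cast hs)
  rw [h] at this
  exact this.trans (min_le_left _ _)

theorem Eqt.nonempty {t : ℕ} {A B : Set ℕ} (h : Eqt t A B) (ht : 2 ≤ t)
    (ha : A.Nonempty) : B.Nonempty := by
  have := h.le (s := 1) (by omega) (by simpa [Set.one_le_encard_iff_nonempty] using ha)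
  simpa [Set.one_le_encard_iff_nonempty] using this

theorem min_add_congr {a a' b b' : ℕ∞} {t : ℕ} (h : min a t = min b t) (h' : min a' t = min b' t) :
    min (a + a') t = min (b + b') t := by
  rcases lt_or_ge a (t : ℕ∞) with ha | ha
  · have hb : b = a := by
      rw [min_eq_left ha.le] at h
      rcases min_choice b (t : ℕ∞) with h2 | h2
      · rw [h, h2]
      · rw [h2] at h; exact absurd h ha.ne
    subst hb
    rcases lt_or_ge a' (t : ℕ∞) with ha' | ha'
    · have hb' : b' = a' := by
        rw [min_eq_left ha'.le] at h'
        rcases min_choice b' (t : ℕ∞) with h2 | h2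
        · rw [h', h2]
        · rw [h2] at h'; exact absurd h' ha'.ne
      rw [hb']
    · have hb' : (t : ℕ∞) ≤ b' := by
        rw [min_eq_right ha'] at h'
        rw [h']; exact min_le_left _ _
      rw [min_eq_right (ha'.trans le_add_self), min_eq_right (hb'.trans le_add_self)]
  · have hb : (t : ℕ∞) ≤ b := by
      rw [min_eq_right ha] at h
      rw [h]; exact min_le_left _ _
    rw [min_eq_right (ha.trans le_self_add), min_eq_right (hb.trans le_self_add)]

theorem glue {C : Type} [Finite C] (t : ℕ) (I J : Set ℕ) (h h' : ℕ → C) (P Q : ℕ → Prop)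
    (H : ∀ c, Eqt t {i | (i ∈ I ∧ h i = c) ∧ P i} {j | (j ∈ J ∧ h' j = c) ∧ Q j}) :
    Eqt t {i | i ∈ I ∧ P i} {j | j ∈ J ∧ Q j} := by
  classical
  have := Fintype.ofFinite C
  have key : ∀ s : Finset C, Eqt t {i | i ∈ I ∧ P i ∧ h i ∈ s} {j | j ∈ J ∧ Q j ∧ h' j ∈ s} := by
    intro s
    induction s using Finset.induction_on with
    | empty => simp [Eqt]
    | insert c s hc ih =>
      have e1 : ∀ (I : Set ℕ) (h : ℕ → C) (P : ℕ → Prop),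
          {i | i ∈ I ∧ P i ∧ h i ∈ insert c s}.encard =
          {i | (i ∈ I ∧ h i = c) ∧ P i}.encard + {i | i ∈ I ∧ P i ∧ h i ∈ s}.encard := by
        intro I h P
        rw [← Set.encard_union_eq]
        · congr 1
          ext i
          simp only [Finset.mem_insert, Set.mem_setOf_eq, Set.mem_union]
          tauto
        · rw [Set.disjoint_left]
          rintro i ⟨⟨_, h1⟩, _⟩ ⟨_, _, h2⟩
          rw [h1] at h2
          exact hc h2
      unfold Eqt
      rw [e1, e1]
      exact min_add_congr (H c) ih
  simpa using key Finset.univ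

theorem fib_encard {D : Type} (f : ℕ → D) (h : ℕ → ℕ) (A B : Set ℕ) (hb : Set.BijOn h B A) (d : D) :
    {j | j ∈ B ∧ f (h j) = d}.encard = {i | i ∈ A ∧ f i = d}.encard := by
  have : {i | i ∈ A ∧ f i = d} = h '' {j | j ∈ B ∧ f (h j) = d} := by
    ext i
    simp only [Set.mem_setOf_eq, Set.mem_image]
    constructor
    · rintro ⟨hi, hd⟩
      obtain ⟨j, hj, rfl⟩ := hb.surjOn hi
      exact ⟨j, ⟨hj, hd⟩, rfl⟩
    · rintro ⟨j, ⟨hj, hd⟩, rfl⟩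
      exact ⟨hb.mapsTo hj, hd⟩
  rw [this, Set.InjOn.encard_image]
  exact hb.injOn.mono fun x hx => hx.1

theorem split {D : Type} [Finite D] [Nonempty D] (t : ℕ) (ht : 2 ≤ t) (A B : Set ℕ) (f : ℕ → D)
    (H : Eqt (Nat.card D * t) A B) :
    ∃ g : ℕ → D, ∀ d, Eqt t {i | i ∈ A ∧ f i = d} {j | j ∈ B ∧ g j = d} := by
  classical
  have := Fintype.ofFinite D
  rcases lt_or_ge A.encard ((Nat.card D * t : ℕ) : ℕ∞) with hA | hA
  · have hAB : B.encard = A.encard := by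
      unfold Eqt at H
      rw [min_eq_left hA.le] at H
      rcases min_choice B.encard ((Nat.card D * t : ℕ) : ℕ∞) with h2 | h2
      · rw [H, h2]
      · rw [h2] at H; exact absurd H hA.ne
    have hfin : B.Finite := by
      rw [← Set.encard_lt_top_iff, hAB]
      exact hA.trans (ENat.coe_lt_top _)
    obtain ⟨h, hh⟩ := hfin.exists_bijOn_of_encard_eq hAB
    exact ⟨f ∘ h, fun d => by unfold Eqt; rw [← fib_encard f h A B hh d]; rfl⟩
  · have hB : ((Nat.card D * t : ℕ) : ℕ∞) ≤ B.encard := H.le le_rfl hA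
    have hC : ∀ d, ∃ C ⊆ {i | i ∈ A ∧ f i = d},
        C.encard = min {i | i ∈ A ∧ f i = d}.encard t := fun d =>
      Set.exists_subset_encard_eq (min_le_left _ _)
    choose C hCs hCe using hC
    have hsum : ∀ (E : D → Set ℕ) (s : Finset D), (∀ d, E d ⊆ {i | i ∈ A ∧ f i = d}) →
        (⋃ d ∈ s, E d).encard = ∑ d ∈ s, (E d).encard := by
      intro E s hE
      induction s using Finset.induction_on with
      | empty => simp
      | insert c s hc ih =>
        rw [Finset.sum_insert hc, ← ih, ← Set.encard_union_eq]
        · congr 1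
          ext i
          simp
        · rw [Set.disjoint_left]
          intro i hi hi'
          simp only [Set.mem_iUnion] at hi'
          obtain ⟨d, hd, hi'⟩ := hi'
          have e1 := (hE _ hi).2
          have e2 := (hE _ hi').2
          rw [e1] at e2
          exact hc (e2 ▸ hd)
    have hd0 : ∃ d0, (t : ℕ∞) ≤ {i | i ∈ A ∧ f i = d0}.encard := by
      by_contra hcon
      push Not at hcon
      have h1 := hsum (fun d => {i | i ∈ A ∧ f i = d}) Finset.univ (fun d => subset_rfl)
      have h2 : (⋃ d ∈ (Finset.univ : Finset D), {i | i ∈ A ∧ f i = d}) = A := by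
        ext i; simp
      rw [h2] at h1
      have h3 : ∀ d, {i | i ∈ A ∧ f i = d}.encard ≤ ((t - 1 : ℕ) : ℕ∞) := by
        intro d
        have := hcon d
        have h4 : ((t - 1 : ℕ) : ℕ∞) + 1 = ((t - 1 + 1 : ℕ) : ℕ∞) := (Nat.cast_succ _).symm
        rw [Nat.sub_add_cancel (by omega)] at h4
        rw [← h4] at this
        exact Order.le_of_lt_add_one this
      have h5 : A.encard ≤ ((Nat.card D * (t - 1) : ℕ) : ℕ∞) := by
        rw [h1]
        refine (Finset.sum_le_sum fun d _ => h3 d).trans ?_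
        simp
      have h6 := hA.trans h5
      have h7 : Nat.card D * t ≤ Nat.card D * (t - 1) := by exact_mod_cast h6
      have h8 : 0 < Nat.card D := Nat.card_pos
      have := Nat.le_of_mul_le_mul_left h7 h8
      omega
    obtain ⟨d0, hd0⟩ := hd0
    have hU := hsum C Finset.univ hCs
    set U := ⋃ d ∈ (Finset.univ : Finset D), C d with hUdef
    have hUle : U.encard ≤ ((Nat.card D * t : ℕ) : ℕ∞) := by
      rw [hU]
      refine (Finset.sum_le_sum fun d _ => (hCe d).le.trans (min_le_right _ _)).trans ?_
      simp
    obtain ⟨B', hB's, hB'e⟩ := Set.exists_subset_encard_eq (hUle.trans hB)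
    have hfin : B'.Finite := by
      rw [← Set.encard_lt_top_iff, hB'e]
      exact hUle.trans_lt (ENat.coe_lt_top _)
    obtain ⟨h, hh⟩ := hfin.exists_bijOn_of_encard_eq hB'e
    have hfib : ∀ d, {i | i ∈ U ∧ f i = d} = C d := by
      intro d
      ext i
      simp only [hUdef, Set.mem_setOf_eq, Set.mem_iUnion, Finset.mem_univ, exists_true_left]
      constructor
      · rintro ⟨⟨d', hd'⟩, hd⟩
        have := (hCs _ hd').2
        rw [hd] at this
        exact this ▸ hd'
      · intro hi
        exact ⟨⟨d, hi⟩, (hCs _ hi).2⟩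
    have hfib' : ∀ d, {j | j ∈ B' ∧ f (h j) = d}.encard = min {i | i ∈ A ∧ f i = d}.encard t := by
      intro d
      rw [fib_encard f h U B' hh d, hfib, hCe]
    refine ⟨fun j => if j ∈ B' then f (h j) else d0, fun d => ?_⟩
    have hsub : {j | j ∈ B' ∧ f (h j) = d} ⊆
        {j | j ∈ B ∧ (if j ∈ B' then f (h j) else d0) = d} := by
      rintro j ⟨hj, hd⟩
      exact ⟨hB's hj, by rw [if_pos hj]; exact hd⟩
    unfold Eqt
    by_cases hd : d = d0
    · subst hd
      have h1 := Set.encard_le_encard hsub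
      rw [hfib', min_eq_right hd0] at h1
      rw [min_eq_right hd0, min_eq_right h1]
    · have : {j | j ∈ B ∧ (if j ∈ B' then f (h j) else d0) = d} = {j | j ∈ B' ∧ f (h j) = d} := by
        apply subset_antisymm _ hsub
        rintro j ⟨hj, hjd⟩
        by_cases hjB : j ∈ B'
        · rw [if_pos hjB] at hjd; exact ⟨hjB, hjd⟩
        · rw [if_neg hjB] at hjd; exact absurd hjd.symm hd
      rw [this, hfib', min_assoc, min_self]


def TI (I : Set ℕ) : Set Node :=
  {τ | τ = [] ∨ ∃ i ∈ I, ∃ p : ℕ, τ = i :: List.replicate p 0}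

def KI (AP : Type) (I : Set ℕ) (hI : I.Nonempty) : KripkeTree AP where
  T := TI I
  root := []
  rooted := by
    refine ⟨Or.inl rfl, fun τ _ => List.nil_prefix, ?_⟩
    intro σ σ' h hp
    simp only [List.nil_append] at h ⊢
    rcases h with rfl | ⟨i, hi, p, rfl⟩
    · left; simpa using hp
    · rcases σ' with _ | ⟨a, l⟩
      · left; rfl
      · rw [List.cons_prefix_cons] at hp
        obtain ⟨rfl, hp⟩ := hp
        right
        refine ⟨a, hi, l.length, ?_⟩
        congr 1
        rw [List.eq_replicate_iff]
        exact ⟨rfl, fun b hb => List.eq_of_mem_replicate (hp.subset hb)⟩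
  nonblocking := by
    intro τ h
    rcases h with rfl | ⟨i, hi, p, rfl⟩
    · obtain ⟨i, hi⟩ := hI
      exact ⟨i, Or.inr ⟨i, hi, 0, rfl⟩⟩
    · refine ⟨0, Or.inr ⟨i, hi, p + 1, ?_⟩⟩
      simp [List.replicate_succ']
  Lab := fun _ => ∅

def comp {W : Type} (i : ℕ) (U : W → Set Node) : W → Set ℕ :=
  fun w => {p | (i :: List.replicate p 0) ∈ U w}

structure Rel {W : Type} (k : ℕ) (I J : Set ℕ) (U U' : W → Set Node) : Prop where
  root : ∀ w, ([] : Node) ∈ U w ↔ ([] : Node) ∈ U' w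
  cnt : ∀ d : Ty W k, Eqt (thr W k) {i | i ∈ I ∧ tp k (comp i U) = d}
    {j | j ∈ J ∧ tp k (comp j U') = d}

theorem Rel.symm {W : Type} {k : ℕ} {I J : Set ℕ} {U U' : W → Set Node} (h : Rel k I J U U') :
    Rel k J I U' U := ⟨fun w => (h.root w).symm, fun d => (h.cnt d).symm⟩

theorem Rel.ex {W : Type} [Finite W] {k : ℕ} {I J : Set ℕ} {U U' : W → Set Node}
    (h : Rel k I J U U') {i : ℕ} (hi : i ∈ I) : ∃ j ∈ J, tp k (comp i U) = tp k (comp j U') := by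
  obtain ⟨j, hj, e⟩ := (h.cnt (tp k (comp i U))).nonempty (thr_two W k) ⟨i, hi, rfl⟩
  exact ⟨j, hj, e.symm⟩

theorem Rel.two {W : Type} [Finite W] {k : ℕ} {I J : Set ℕ} {U U' : W → Set Node}
    (h : Rel k I J U U') {i i' : ℕ} (hi : i ∈ I) (hi' : i' ∈ I) (hne : i ≠ i')
    (he : tp k (comp i U) = tp k (comp i' U)) :
    ∃ j ∈ J, ∃ j' ∈ J, j ≠ j' ∧ tp k (comp j U') = tp k (comp i U) ∧
      tp k (comp j' U') = tp k (comp i U) := by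
  have h2 := (h.cnt (tp k (comp i U))).le (s := 2) (thr_two W k) (by
    have h1 : (1 : ℕ∞) < {i_1 | i_1 ∈ I ∧ tp k (comp i_1 U) = tp k (comp i U)}.encard :=
      Set.one_lt_encard_iff.2 ⟨i, i', ⟨hi, rfl⟩, ⟨hi', he.symm⟩, hne⟩
    have := Order.add_one_le_of_lt h1
    rw [one_add_one_eq_two] at this
    exact_mod_cast this)
  have h3 : (1 : ℕ∞) < {j | j ∈ J ∧ tp k (comp j U') = tp k (comp i U)}.encard :=
    lt_of_lt_of_le (by norm_num) h2
  obtain ⟨j, j', hj, hj', hne⟩ := Set.one_lt_encard_iff.1 h3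
  exact ⟨j, hj.1, j', hj'.1, hne, hj.2, hj'.2⟩

theorem comp_update {W : Type} [DecidableEq W] (i : ℕ) (U : W → Set Node) (w : W) (S : Set Node) :
    comp i (Function.update U w S) =
      Function.update (comp i U) w {p | (i :: List.replicate p 0) ∈ S} := by
  funext v
  by_cases h : v = w
  · subst h; simp [comp]
  · simp [comp, h]

theorem tp_update {W : Type} [DecidableEq W] (k : ℕ) (s : W → Set ℕ) (w : W) (d : Ty W k) :
    d ∈ (tp (k + 1) s).2 w ↔ ∃ A, tp k (Function.update s w A) = d := by
  simp only [tp, Set.mem_range]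
  constructor
  · rintro ⟨A, h⟩; exact ⟨A, by convert h⟩
  · rintro ⟨A, h⟩; exact ⟨A, by convert h⟩

theorem step {W : Type} [Finite W] [DecidableEq W] {k : ℕ} {I J : Set ℕ} {U U' : W → Set Node}
    (h : Rel (k + 1) I J U U') (w : W) (S : Set Node) :
    ∃ S' ⊆ TI J, Rel k I J (Function.update U w S) (Function.update U' w S') := by
  classical
  have f0 := finite_Ty W k
  have f1 := finite_Ty W (k + 1)
  have : Nonempty (Ty W k) := ⟨tp k fun _ => ∅⟩
  have ht := thr_two W k
  let f : ℕ → Ty W k := fun i => tp k (comp i (Function.update U w S))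
  have hg := fun c => split (thr W k) ht _ _ f (h.cnt c)
  choose g hg using hg
  let g' : ℕ → Ty W k := fun j => g (tp (k + 1) (comp j U')) j
  have hA : ∀ j, ∃ A : Set ℕ, j ∈ J → tp k (Function.update (comp j U') w A) = g' j := by
    intro j
    by_cases hj : j ∈ J
    · obtain ⟨i, ⟨hi, hti⟩, hfi⟩ := (hg (tp (k + 1) (comp j U')) (g' j)).symm.nonempty ht
        ⟨j, ⟨hj, rfl⟩, rfl⟩
      have h1 : g' j ∈ (tp (k + 1) (comp i U)).2 w := by
        rw [tp_update, ← hfi]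
        exact ⟨_, congrArg (tp k) (comp_update i U w S).symm⟩
      rw [hti, tp_update] at h1
      obtain ⟨A, hA⟩ := h1
      exact ⟨A, fun _ => hA⟩
    · exact ⟨∅, fun h => absurd h hj⟩
  choose A hA using hA
  let S' : Set Node := {τ | (τ = [] ∧ ([] : Node) ∈ S) ∨
    ∃ j ∈ J, ∃ p ∈ A j, τ = j :: List.replicate p 0}
  have hc : ∀ j ∈ J, {p | (j :: List.replicate p 0) ∈ S'} = A j := by
    intro j hj
    ext p
    constructor
    · rintro (⟨h, _⟩ | ⟨j', hj', q, hq, h⟩)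
      · cases h
      · rw [List.cons.injEq] at h
        obtain ⟨rfl, h⟩ := h
        have := congrArg List.length h
        simp only [List.length_replicate] at this
        rwa [this]
    · intro hp
      exact Or.inr ⟨j, hj, p, hp, rfl⟩
  refine ⟨S', ?_, ?_, ?_⟩
  · rintro τ (⟨h, _⟩ | ⟨j, hj, p, _, h⟩)
    · exact Or.inl h
    · exact Or.inr ⟨j, hj, p, h⟩
  · intro v
    by_cases hv : v = w
    · subst hv
      simp [S']
    · simpa [hv] using h.root v
  · intro d
    apply glue (thr W k) I J (fun i => tp (k + 1) (comp i U)) (fun j => tp (k + 1) (comp j U'))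
    intro c
    have e : {j | (j ∈ J ∧ tp (k + 1) (comp j U') = c) ∧
        tp k (comp j (Function.update U' w S')) = d} =
        {j | (j ∈ J ∧ tp (k + 1) (comp j U') = c) ∧ g c j = d} := by
      ext j
      simp only [Set.mem_setOf_eq, and_congr_right_iff]
      rintro ⟨hj, rfl⟩
      rw [comp_update, hc j hj, hA j hj]
    rw [e]
    exact hg c d

theorem nil_of_Rel {W : Type} [Finite W] {k : ℕ} {I J : Set ℕ} {U U' : W → Set Node}
    (h : Rel k I J U U') (w : W) (τ : Node) (hτ : τ ∈ TI I) (hU : U w = {τ}) (hS : U' w ⊆ TI J) :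
    ∃ τ' ∈ TI J, U' w = {τ'} := by
  rcases hτ with rfl | ⟨i, hi, p, rfl⟩
  · refine ⟨[], Or.inl rfl, ?_⟩
    apply subset_antisymm
    · intro σ hσ
      rcases hS hσ with rfl | ⟨j, hj, q, rfl⟩
      · rfl
      · obtain ⟨i, hi, he⟩ := h.symm.ex hj
        obtain ⟨r, hr, _⟩ := (tp_f1 he w w).1 ⟨q, hσ, hσ⟩
        simp [comp, hU] at hr
    · rintro _ rfl
      rw [← h.root, hU]; rfl
  · have hn : ([] : Node) ∉ U' w := by rw [← h.root, hU]; simp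
    have huniq : ∀ i', ∀ r, r ∈ comp i' U w → i' = i ∧ r = p := by
      intro i' r hr
      simp only [comp, hU, Set.mem_setOf_eq, Set.mem_singleton_iff, List.cons.injEq] at hr
      refine ⟨hr.1, ?_⟩
      simpa using congrArg List.length hr.2
    have hip : p ∈ comp i U w := by simp [comp, hU]
    obtain ⟨j, hj, he⟩ := h.ex hi
    obtain ⟨q, hq, _⟩ := (tp_f1 he w w).1 ⟨p, hip, hip⟩
    have hsub : (comp j U' w).Subsingleton := (tp_f3 he w).1 (by
      intro a ha b hb
      rw [(huniq _ _ ha).2, (huniq _ _ hb).2])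
    refine ⟨j :: List.replicate q 0, Or.inr ⟨j, hj, q, rfl⟩, ?_⟩
    apply subset_antisymm
    · intro σ hσ
      rcases hS hσ with rfl | ⟨j', hj', q', rfl⟩
      · exact absurd hσ hn
      · by_cases hjj : j = j'
        · subst hjj
          rw [hsub hq hσ]; rfl
        · exfalso
          obtain ⟨i', hi', he'⟩ := h.symm.ex hj'
          obtain ⟨r, hr, _⟩ := (tp_f1 he' w w).1 ⟨q', hσ, hσ⟩
          obtain ⟨rfl, _⟩ := huniq _ _ hr
          obtain ⟨a, ha, b, hb, hne, ea, eb⟩ := h.symm.two hj hj' hjj (he.symm.trans he'.symm)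
          obtain ⟨r1, hr1, _⟩ := (tp_f1 ea w w).2 ⟨q, hq, hq⟩
          obtain ⟨r2, hr2, _⟩ := (tp_f1 eb w w).2 ⟨q, hq, hq⟩
          exact hne ((huniq _ _ hr1).1.trans (huniq _ _ hr2).1.symm)
    · rintro _ rfl
      exact hq

def enc {N : ℕ} (V1 : ℕ → Node) (V2 : ℕ → Set Node) : Bool × Fin N → Set Node :=
  fun w => if w.1 then V2 w.2 else {V1 w.2}

theorem enc_FO {N : ℕ} (V1 : ℕ → Node) (V2 : ℕ → Set Node) (x : ℕ) (hx : x < N) (τ : Node) :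
    (enc (Function.update V1 x τ) V2 : Bool × Fin N → Set Node) =
      Function.update (enc V1 V2) (false, ⟨x, hx⟩) {τ} := by
  funext ⟨b, v⟩
  cases b
  · by_cases h : v = ⟨x, hx⟩
    · subst h; simp [enc]
    · have : (v : ℕ) ≠ x := fun e => h (Fin.ext e)
      simp [enc, h, this]
  · simp [enc]

theorem enc_SO {N : ℕ} (V1 : ℕ → Node) (V2 : ℕ → Set Node) (x : ℕ) (hx : x < N) (S : Set Node) :
    (enc V1 (Function.update V2 x S) : Bool × Fin N → Set Node) =
      Function.update (enc V1 V2) (true, ⟨x, hx⟩) S := by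
  funext ⟨b, v⟩
  cases b
  · simp [enc]
  · by_cases h : v = ⟨x, hx⟩
    · subst h; simp [enc]
    · have : (v : ℕ) ≠ x := fun e => h (Fin.ext e)
      simp [enc, h, this]

def qr {AP : Type} : MSOL AP → ℕ
  | .atom _ _ => 0
  | .le _ _ => 0
  | .mem _ _ => 0
  | .not φ => qr φ
  | .and φ ψ => max (qr φ) (qr ψ)
  | .exFO _ φ => qr φ + 1
  | .exSO _ φ => qr φ + 1

def vb {AP : Type} : MSOL AP → ℕ
  | .atom _ x => x + 1
  | .le x y => max x y + 1
  | .mem x y => max x y + 1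
  | .not φ => vb φ
  | .and φ ψ => max (vb φ) (vb ψ)
  | .exFO x φ => max (x + 1) (vb φ)
  | .exSO x φ => max (x + 1) (vb φ)

theorem le_char {N : ℕ} (I : Set ℕ) (V1 : ℕ → Node) (V2 : ℕ → Set Node) (hV : ∀ x, V1 x ∈ TI I)
    (x y : Fin N) : V1 x <+: V1 y ↔ ([] ∈ enc (N := N) V1 V2 (false, x) ∨
      ∃ i ∈ I, ∃ p ∈ comp i (enc (N := N) V1 V2) (false, x),
        ∃ q ∈ comp i (enc (N := N) V1 V2) (false, y), p ≤ q) := by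
  simp only [enc, comp, Set.mem_setOf_eq]
  constructor
  · intro h
    rcases hV x with hx | ⟨i, hi, p, hx⟩
    · left; simp [hx]
    · right
      rw [hx] at h
      rcases hV y with hy | ⟨j, hj, q, hy⟩
      · rw [hy] at h; simp at h
      · rw [hy, List.cons_prefix_cons] at h
        obtain ⟨rfl, h⟩ := h
        refine ⟨i, hi, p, by simp [hx], q, by simp [hy], ?_⟩
        simpa using h.length_le
  · rintro (h | ⟨i, hi, p, hp, q, hq, hpq⟩)
    · simp at h
      rw [h]; exact List.nil_prefix
    · simp at hp hq
      rw [← hp, ← hq, List.cons_prefix_cons]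
      refine ⟨rfl, ?_⟩
      obtain ⟨r, rfl⟩ := Nat.exists_eq_add_of_le hpq
      rw [List.replicate_add]
      exact List.prefix_append _ _

theorem mem_char {N : ℕ} (I : Set ℕ) (V1 : ℕ → Node) (V2 : ℕ → Set Node) (hV : ∀ x, V1 x ∈ TI I)
    (x y : Fin N) : V1 x ∈ V2 y ↔ (([] ∈ enc (N := N) V1 V2 (false, x) ∧
      [] ∈ enc (N := N) V1 V2 (true, y)) ∨
      ∃ i ∈ I, ∃ p, p ∈ comp i (enc (N := N) V1 V2) (false, x) ∧
        p ∈ comp i (enc (N := N) V1 V2) (true, y)) := by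
  simp only [enc, comp, Set.mem_setOf_eq]
  constructor
  · intro h
    rcases hV x with hx | ⟨i, hi, p, hx⟩
    · left; rw [hx] at h; simp [hx, h]
    · right
      rw [hx] at h
      exact ⟨i, hi, p, by simp [hx], by simpa using h⟩
  · rintro (⟨h, h'⟩ | ⟨i, hi, p, hp, hq⟩)
    · simp at h h'
      rw [h]; exact h'
    · simp at hp hq
      rw [← hp]; exact hq

theorem half_char {W : Type} [Finite W] {k : ℕ} {I J : Set ℕ} {U U' : W → Set Node}
    (h : Rel k I J U U') (P : (W → Set ℕ) → Prop)
    (hP : ∀ s s', tp k s = tp k s' → (P s ↔ P s')) :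
    (∃ i ∈ I, P (comp i U)) ↔ (∃ j ∈ J, P (comp j U')) := by
  constructor
  · rintro ⟨i, hi, hp⟩
    obtain ⟨j, hj, he⟩ := h.ex hi
    exact ⟨j, hj, (hP _ _ he).1 hp⟩
  · rintro ⟨i, hi, hp⟩
    obtain ⟨j, hj, he⟩ := h.symm.ex hi
    exact ⟨j, hj, (hP _ _ he).1 hp⟩

theorem main_game {AP : Type} {N : ℕ} (φ : MSOL AP) : ∀ (k : ℕ) (I J : Set ℕ) (hI : I.Nonempty)
    (hJ : J.Nonempty) (V1 V1' : ℕ → Node) (V2 V2' : ℕ → Set Node),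
    vb φ ≤ N → qr φ ≤ k → (∀ x, V1 x ∈ TI I) → (∀ x, V1' x ∈ TI J) →
    Rel k I J (enc V1 V2 : Bool × Fin N → Set Node) (enc V1' V2') →
    (Sat MSOdom (KI AP I hI) V1 V2 φ ↔ Sat MSOdom (KI AP J hJ) V1' V2' φ) := by
  induction φ with
  | atom a x => intros; simp [Sat, KI]
  | le x y =>
    intro k I J hI hJ V1 V1' V2 V2' hv hq h1 h1' hR
    simp only [vb] at hv
    have a := le_char I V1 V2 h1 (⟨x, by omega⟩ : Fin N) ⟨y, by omega⟩
    have b := le_char J V1' V2' h1' (⟨x, by omega⟩ : Fin N) ⟨y, by omega⟩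
    simp only [Sat]
    have e1 : V1 x ∈ (KI AP I hI).T := h1 x
    have e2 : V1 y ∈ (KI AP I hI).T := h1 y
    have e3 : V1' x ∈ (KI AP J hJ).T := h1' x
    have e4 : V1' y ∈ (KI AP J hJ).T := h1' y
    simp only [e1, e2, e3, e4, true_and]
    rw [a, b, hR.root]
    exact or_congr Iff.rfl (half_char hR _ fun s s' he => tp_f2 he _ _)
  | mem x y =>
    intro k I J hI hJ V1 V1' V2 V2' hv hq h1 h1' hR
    simp only [vb] at hv
    have a := mem_char I V1 V2 h1 (⟨x, by omega⟩ : Fin N) ⟨y, by omega⟩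
    have b := mem_char J V1' V2' h1' (⟨x, by omega⟩ : Fin N) ⟨y, by omega⟩
    simp only [Sat]
    rw [a, b, hR.root, hR.root]
    exact or_congr Iff.rfl (half_char hR _ fun s s' he => tp_f1 he _ _)
  | not φ ih =>
    intro k I J hI hJ V1 V1' V2 V2' hv hq h1 h1' hR
    exact not_congr (ih k I J hI hJ V1 V1' V2 V2' hv hq h1 h1' hR)
  | and φ ψ ih ih' =>
    intro k I J hI hJ V1 V1' V2 V2' hv hq h1 h1' hR
    simp only [vb, qr, max_le_iff] at hv hq
    exact and_congr (ih k I J hI hJ V1 V1' V2 V2' hv.1 hq.1 h1 h1' hR)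
      (ih' k I J hI hJ V1 V1' V2 V2' hv.2 hq.2 h1 h1' hR)
  | exFO x φ ih =>
    have half : ∀ (k : ℕ) (I J : Set ℕ) (hI : I.Nonempty)
        (hJ : J.Nonempty) (V1 V1' : ℕ → Node) (V2 V2' : ℕ → Set Node),
        vb (MSOL.exFO x φ) ≤ N → qr (MSOL.exFO x φ) ≤ k →
        (∀ x, V1 x ∈ TI I) → (∀ x, V1' x ∈ TI J) →
        Rel k I J (enc V1 V2 : Bool × Fin N → Set Node) (enc V1' V2') →
        Sat MSOdom (KI AP I hI) V1 V2 (MSOL.exFO x φ) →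
          Sat MSOdom (KI AP J hJ) V1' V2' (MSOL.exFO x φ) := by
      intro k I J hI hJ V1 V1' V2 V2' hv hq h1 h1' hR
      simp only [vb, qr, max_le_iff] at hv hq
      obtain ⟨k, rfl⟩ : ∃ k', k = k' + 1 := ⟨k - 1, by omega⟩
      rintro ⟨τ, hτ, hs⟩
      obtain ⟨S', hS', hR'⟩ := step hR (false, ⟨x, hv.1⟩) {τ}
      obtain ⟨τ', hτ', e⟩ := nil_of_Rel hR' (false, ⟨x, hv.1⟩) τ hτ (by simp) (by simpa using hS')
      simp only [Function.update_self] at e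
      subst e
      refine ⟨τ', hτ', ?_⟩
      rw [← enc_FO, ← enc_FO] at hR'
      refine (ih k I J hI hJ _ _ _ _ hv.2 (by omega) ?_ ?_ hR').1 hs
      · intro y
        by_cases hy : y = x
        · subst hy; rw [Function.update_self]; exact hτ
        · simpa [hy] using h1 y
      · intro y
        by_cases hy : y = x
        · subst hy; simpa using hτ'
        · simpa [hy] using h1' y
    intro k I J hI hJ V1 V1' V2 V2' hv hq h1 h1' hR
    exact ⟨half k I J hI hJ V1 V1' V2 V2' hv hq h1 h1' hR,
      half k J I hJ hI V1' V1 V2' V2 hv hq h1' h1 hR.symm⟩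
  | exSO x φ ih =>
    have half : ∀ (k : ℕ) (I J : Set ℕ) (hI : I.Nonempty)
        (hJ : J.Nonempty) (V1 V1' : ℕ → Node) (V2 V2' : ℕ → Set Node),
        vb (MSOL.exSO x φ) ≤ N → qr (MSOL.exSO x φ) ≤ k →
        (∀ x, V1 x ∈ TI I) → (∀ x, V1' x ∈ TI J) →
        Rel k I J (enc V1 V2 : Bool × Fin N → Set Node) (enc V1' V2') →
        Sat MSOdom (KI AP I hI) V1 V2 (MSOL.exSO x φ) →
          Sat MSOdom (KI AP J hJ) V1' V2' (MSOL.exSO x φ) := by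
      intro k I J hI hJ V1 V1' V2 V2' hv hq h1 h1' hR
      simp only [vb, qr, max_le_iff] at hv hq
      obtain ⟨k, rfl⟩ : ∃ k', k = k' + 1 := ⟨k - 1, by omega⟩
      rintro ⟨S, hS, hs⟩
      obtain ⟨S', hS', hR'⟩ := step hR (true, ⟨x, hv.1⟩) S
      refine ⟨S', hS', ?_⟩
      rw [← enc_SO, ← enc_SO] at hR'
      exact (ih k I J hI hJ _ _ _ _ hv.2 (by omega) h1 h1' hR').1 hs
    intro k I J hI hJ V1 V1' V2 V2' hv hq h1 h1' hR
    exact ⟨half k I J hI hJ V1 V1' V2 V2' hv hq h1 h1' hR,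
      half k J I hJ hI V1' V1 V2' V2 hv hq h1' h1 hR.symm⟩

/-- there is an infinite antichain -/
def chi (AP : Type) : MSOL AP :=
  .exSO 0 (.not (.exFO 0 (.exFO 1 (.and (.mem 0 0) (.and (.mem 1 0)
    (.and (.le 0 1) (.not (.le 1 0))))))))

theorem chi_sentence (AP : Type) : (chi AP).IsSentence := by
  constructor
  · simp only [chi, MSOL.freeFO]
    ext x; simp
  · simp [chi, MSOL.freeSO]

theorem chi_char {AP : Type} (K : KripkeTree AP) (V1 : ℕ → Node) (V2 : ℕ → Set Node) :
    Sat (coweakDom MSOdom) K V1 V2 (chi AP) ↔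
      ∃ X, X ⊆ K.T ∧ X.Infinite ∧ ∀ a ∈ X, ∀ b ∈ X, a <+: b → a = b := by
  simp only [chi, Sat, coweakDom, MSOdom, Set.mem_setOf_eq]
  constructor
  · rintro ⟨X, ⟨hX, hi⟩, h⟩
    refine ⟨X, hX, hi, fun a ha b hb hab => ?_⟩
    by_contra hne
    apply h
    refine ⟨a, hX ha, b, hX hb, ?_⟩
    simp [ha, hb, hX ha, hX hb, hab]
    intro hba
    exact hne (hab.eq_of_length_le hba.length_le)
  · rintro ⟨X, hX, hi, h⟩
    refine ⟨X, ⟨hX, hi⟩, ?_⟩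
    rintro ⟨a, ha, b, hb, hs⟩
    simp [ha, hb] at hs
    obtain ⟨ha', hb', hab, hn⟩ := hs
    have := h a ha' b hb' hab
    subst this
    exact hn (List.prefix_refl _)

theorem not_leq_MSO (AP : Type) : ¬ MLogic.Leq (allKT AP) (CoWMSO AP) (MSO AP) := by
  intro H
  obtain ⟨φ, hφ, -, hK⟩ := H (chi AP) (chi_sentence AP) trivial
  let N := vb φ
  let k := qr φ
  let n := thr (Bool × Fin N) k
  have hn : 2 ≤ n := thr_two _ _
  have hI : (Set.univ : Set ℕ).Nonempty := ⟨0, trivial⟩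
  have hJ : {i : ℕ | i < n}.Nonempty := ⟨0, by simp; omega⟩
  have h1 := hK (KI AP _ hI) trivial
  have h2 := hK (KI AP _ hJ) trivial
  rw [ksat_iff _ _ _ (chi_sentence AP) (fun _ => []) (fun _ => ∅),
    ksat_iff _ _ _ hφ (fun _ => []) (fun _ => ∅)] at h1 h2
  have hc : ∀ i, comp i (enc (fun _ => []) (fun _ => ∅) : Bool × Fin N → Set Node) =
      fun _ => ∅ := by
    intro i
    funext ⟨b, v⟩
    cases b <;> simp [comp, enc]
  have h3 := main_game (N := N) φ k _ _ hI hJ (fun _ => []) (fun _ => []) (fun _ => ∅) (fun _ => ∅)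
    le_rfl le_rfl (fun _ => Or.inl rfl) (fun _ => Or.inl rfl) ⟨fun _ => Iff.rfl, fun d => by
      simp only [hc]
      by_cases hd : tp k (fun _ : Bool × Fin N => (∅ : Set ℕ)) = d
      · simp only [hd, and_true, Set.setOf_mem_eq, Eqt]
        have e : {i : ℕ | i < n}.encard = n := by
          have : {i : ℕ | i < n} = ((Finset.range n : Finset ℕ) : Set ℕ) := by ext; simp
          rw [this, Set.encard_coe_eq_coe_finsetCard]; simp
        simp only [Set.mem_univ, Set.mem_setOf_eq, Set.setOf_true, e]
        simp [n]
      · simp [hd, Eqt]⟩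
  have h4 : Sat (coweakDom MSOdom) (KI AP _ hI) (fun _ => []) (fun _ => ∅) (chi AP) := by
    rw [chi_char]
    refine ⟨Set.range fun i : ℕ => [i], ?_, ?_, ?_⟩
    · rintro _ ⟨i, rfl⟩
      exact Or.inr ⟨i, trivial, 0, rfl⟩
    · apply Set.infinite_range_of_injective
      intro a b h; simpa using h
    · rintro _ ⟨i, rfl⟩ _ ⟨j, rfl⟩ h
      exact h.eq_of_length rfl
  have h5 : Sat (coweakDom MSOdom) (KI AP _ hJ) (fun _ => []) (fun _ => ∅) (chi AP) :=
    h2.2 (h3.1 (h1.1 h4))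
  rw [chi_char] at h5
  obtain ⟨X, hX, hi, ha⟩ := h5
  have hfin : ((insert none (some '' {i : ℕ | i < n})) : Set (Option ℕ)).Finite :=
    ((Set.finite_lt_nat n).image _).insert _
  have hm : Set.MapsTo (fun τ : Node => τ.head?) X (insert none (some '' {i : ℕ | i < n})) := by
    intro τ hτ
    rcases hX hτ with rfl | ⟨i, hi, p, rfl⟩
    · exact Or.inl rfl
    · exact Or.inr ⟨i, hi, rfl⟩
  obtain ⟨a, haX, b, hbX, hne, he⟩ := hi.exists_ne_map_eq_of_mapsTo hm hfin
  have hcmp : a <+: b ∨ b <+: a := by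
    rcases hX haX with rfl | ⟨i, hi, p, rfl⟩
    · exact Or.inl List.nil_prefix
    · rcases hX hbX with rfl | ⟨j, hj, q, rfl⟩
      · exact Or.inr List.nil_prefix
      · simp at he
        subst he
        rcases le_total p q with h | h
        · left
          obtain ⟨r, rfl⟩ := Nat.exists_eq_add_of_le h
          rw [List.replicate_add, List.cons_prefix_cons]
          exact ⟨rfl, List.prefix_append _ _⟩
        · right
          obtain ⟨r, rfl⟩ := Nat.exists_eq_add_of_le h
          rw [List.replicate_add, List.cons_prefix_cons]
          exact ⟨rfl, List.prefix_append _ _⟩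
  rcases hcmp with h | h
  · exact hne (ha _ haX _ hbX h)
  · exact hne (ha _ hbX _ haX h).symm

end S13

/-- over all Kripke trees, MSO < CoWMSO and WMSO < CoWMSO;
over finitely-branching Kripke trees, MSO ≡ CoWMSO and WMSO < CoWMSO. -/
theorem stmt13 (AP : Type) [Fintype AP] :
    MLogic.Lt (allKT AP) (MSO AP) (CoWMSO AP) ∧
    MLogic.Lt (allKT AP) (WMSO AP) (CoWMSO AP) ∧
    MLogic.EquivExp (finBrKT AP) (MSO AP) (CoWMSO AP) ∧
    MLogic.Lt (finBrKT AP) (WMSO AP) (CoWMSO AP) := by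
  exact ⟨⟨S13.leq_MSO _, S13.not_leq_MSO AP⟩,
    ⟨S13.leq_WMSO _, fun h => S13.not_leq_WMSO (fun φ h1 h2 =>
      let ⟨φ', a, b, c⟩ := h φ h1 h2
      ⟨φ', a, b, fun K _ => c K trivial⟩)⟩,
    ⟨S13.leq_MSO _, S13.leq_CoWMSO⟩,
    ⟨S13.leq_WMSO _, S13.not_leq_WMSO⟩⟩
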